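/- arXiv:2409.17528 — 4 statements merged into one kernel-verified Lean document; each statement's English description precedes it below -/
import Mathlib

section
/- Let n ∈ ℕ. Define c_{n,n} = 1 and, for 0 ≤ k < n, let c_{n,k} be the coefficient of x^k in the polynomial (x + 3/2)·(−1)^{n−k}·(x+3)^{n−k−1}·(x−2)^n. Then for every Schwartz vector field u : ℝ³ → ℝ³, −⟨S^n u, S^n(Δu)⟩_{L²} = Σ_{k=0}^{n} c_{n,k} ‖∇S^k u‖²_{L²}. -/
open MeasureTheory Filter Topology
open scoped FourierTransform ENNReal RealInnerProductSpace BigOperators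

noncomputable section

abbrev E3 : Type := EuclideanSpace ℝ (Fin 3)

namespace NSCPaper

/-- Standard basis vector of `ℝ³`. -/
def ebasis (k : Fin 3) : E3 := EuclideanSpace.single k 1

variable {F : Type*} [NormedAddCommGroup F] [NormedSpace ℝ F]

/-- Partial derivative `∂_k f`. -/
def pd (f : E3 → F) (k : Fin 3) : E3 → F := fun x => fderiv ℝ f x (ebasis k)

/-- Laplacian `Δf = Σ_k ∂_k ∂_k f`. -/
def lap (f : E3 → F) : E3 → F := fun x => ∑ k : Fin 3, pd (pd f k) k x

/-- Scaling vector field acting on vector fields: `Sv = (x·∇)v − v`. -/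
def Svec (v : E3 → E3) : E3 → E3 := fun x => fderiv ℝ v x x - v x

/-- Scaling vector field acting on scalar functions: `Sf = x·∇f − 2f`. -/
def Sscal (f : E3 → F) : E3 → F := fun x => fderiv ℝ f x x - (2:ℝ) • f x

/-- Iterates `S^n` of the scalar scaling vector field on complex valued functions. -/
def SscalIter (n : ℕ) (f : E3 → ℂ) : E3 → ℂ := (fun g : E3 → ℂ => Sscal g)^[n] f

/-- Squared `L²` norm. -/
def L2normSq (f : E3 → F) : ℝ := ∫ x : E3, ‖f x‖^2

/-- `L²` norm. -/
def L2norm (f : E3 → F) : ℝ := Real.sqrt (L2normSq f)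

/-- `L^∞` norm. -/
def LinfNorm (f : E3 → F) : ℝ := (eLpNorm f ⊤ volume).toReal

/-- `‖∇v‖_{L^∞}`. -/
def gradLinf (v : E3 → E3) : ℝ := LinfNorm (fun x => fderiv ℝ v x)

/-- `‖∇v‖²_{L²} = Σ_{i,k} ‖∂_k v_i‖²_{L²}`. -/
def gradNormSq (v : E3 → E3) : ℝ := ∑ i : Fin 3, ∑ k : Fin 3, L2normSq (pd (fun x => v x i) k)

/-- A function is Schwartz if it agrees with an element of the Schwartz space. -/
def IsSchwartz (f : E3 → F) : Prop := ∃ g : SchwartzMap E3 F, ⇑g = f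

/-- The vector `(a,b,c) ∈ ℝ³`. -/
def vec3 (a b c : ℝ) : E3 := (EuclideanSpace.equiv (Fin 3) ℝ).symm ![a, b, c]

/-- `e₃ × v = (−v₂, v₁, 0)`. -/
def e3cross (v : E3) : E3 := vec3 (-(v 1)) (v 0) 0

/-- Gradient of a scalar function. -/
def grad (f : E3 → ℝ) : E3 → E3 := fun x => (EuclideanSpace.equiv (Fin 3) ℝ).symm (fun k => pd f k x)

/-- Divergence of a vector field. -/
def divg (v : E3 → E3) : E3 → ℝ := fun x => ∑ k : Fin 3, pd (fun y => v y k) k x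

/-- Iterated partial derivative `∂^μ f` for a multi-index `μ`. -/
def pdIter (f : E3 → F) (μ : Fin 3 → ℕ) : E3 → F :=
  (fun g => pd g 0)^[μ 0] ((fun g => pd g 1)^[μ 1] ((fun g => pd g 2)^[μ 2] f))

/-- Squared Sobolev norm `‖f‖²_{H^m} = Σ_{|μ| ≤ m} ‖∂^μ f‖²_{L²}`. -/
def HmNormSq (m : ℕ) (f : E3 → F) : ℝ :=
  ∑ μ : Fin 3 → Fin (m+1),
    if (∑ i, (μ i : ℕ)) ≤ m then L2normSq (pdIter f (fun i => (μ i : ℕ))) else 0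

/-- Sobolev norm `‖f‖_{H^m}`. -/
def HmNorm (m : ℕ) (f : E3 → F) : ℝ := Real.sqrt (HmNormSq m f)

/-- `ℝ≥0∞`-valued Sobolev norm, used to express membership in `H^m`. -/
def HmNormE (m : ℕ) (f : E3 → F) : ℝ≥0∞ :=
  ∑ μ : Fin 3 → Fin (m+1),
    if (∑ i, (μ i : ℕ)) ≤ m then eLpNorm (pdIter f (fun i => (μ i : ℕ))) 2 volume else 0

/-- The Navier–Stokes–Coriolis system with viscosity `κ` on the time interval `I`:
`∂_t u − κΔu + (u·∇)u + e₃×u + ∇p = 0`, `div u = 0`. -/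
structure IsNSCSolutionOn (κ : ℝ) (I : Set ℝ) (u : ℝ → E3 → E3) (p : ℝ → E3 → ℝ) : Prop where
  reg_u : ∀ t ∈ I, ContDiff ℝ 2 (u t)
  reg_p : ∀ t ∈ I, ContDiff ℝ 1 (p t)
  eqn : ∀ t ∈ I, ∀ x : E3,
    HasDerivWithinAt (fun s => u s x)
      (κ • lap (u t) x - fderiv ℝ (u t) x (u t x) - e3cross (u t x) - grad (p t) x) I t
  divfree : ∀ t ∈ I, ∀ x : E3, divg (u t) x = 0

/-- A smooth solution of NSC on `[0,T]` which is Schwartz at each time. -/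
structure IsSmoothSchwartzSolution (κ T : ℝ) (u : ℝ → E3 → E3) (p : ℝ → E3 → ℝ) : Prop where
  sol : IsNSCSolutionOn κ (Set.Icc 0 T) u p
  usmooth : ContDiff ℝ (⊤ : ℕ∞) (Function.uncurry u)
  psmooth : ContDiff ℝ (⊤ : ℕ∞) (Function.uncurry p)
  uschwartz : ∀ t, IsSchwartz (u t)
  pschwartz : ∀ t, IsSchwartz (p t)

/-- Fourier multiplier operator with symbol `m`. -/
def fmul (m : E3 → ℂ) (f : E3 → ℂ) : E3 → ℂ := 𝓕⁻ (fun ξ => m ξ * 𝓕 f ξ)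

/-- `Σ_i ‖|∇|⁻¹ v_i‖²_{L²}` where `|∇|⁻¹` is the Fourier multiplier with symbol `|ξ|⁻¹`. -/
def hNeg1NormSqVec (v : E3 → E3) : ℝ :=
  ∑ i : Fin 3, L2normSq (fmul (fun ξ => ((‖ξ‖⁻¹ : ℝ) : ℂ)) (fun y => ((v y i : ℝ) : ℂ)))

/-- `‖|∇|⁻¹ v‖_{L²}` for vector fields. -/
def hNeg1NormVec (v : E3 → E3) : ℝ := Real.sqrt (hNeg1NormSqVec v)

/-- Homogeneous `Ḣ^{−1}` norm of a scalar function. -/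
def HdotNeg1Norm (f : E3 → ℂ) : ℝ := L2norm (fmul (fun ξ => ((‖ξ‖⁻¹ : ℝ) : ℂ)) f)

/-- Heat kernel on `ℝ³` at time `τ`. -/
def heatKernel (τ : ℝ) (z : E3) : ℝ :=
  (4 * Real.pi * τ) ^ (-(3:ℝ)/2) * Real.exp (-‖z‖^2 / (4*τ))

/-- Heat semigroup `e^{τΔ}` (the identity for `τ ≤ 0`). -/
def heatOp (τ : ℝ) (f : E3 → ℂ) : E3 → ℂ :=
  if τ ≤ 0 then f else fun x => ∫ y : E3, (heatKernel τ (x - y) : ℂ) * f y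

/-- Dispersion relation `Λ(ξ) = ξ₃/|ξ|`. -/
def Lam (ξ : E3) : ℝ := ξ 2 / ‖ξ‖

/-- Norm of the horizontal component `ξ_h = (ξ₁,ξ₂)`. -/
def horNorm (ξ : E3) : ℝ := Real.sqrt ((ξ 0)^2 + (ξ 1)^2)

/-- The set of signs `{+1, −1}`. -/
def pmSet : Set ℝ := {1, -1}

/-- The phase `Φ_μ^{μ₁,μ₂}(ξ,η) = μΛ(ξ) + μ₁Λ(ξ−η) + μ₂Λ(η)`. -/
def Phase (μ μ₁ μ₂ : ℝ) (ξ η : E3) : ℝ := μ * Lam ξ + μ₁ * Lam (ξ - η) + μ₂ * Lam η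

/-- The vector `(a,b) ∈ ℝ²`. -/
def vec2 (a b : ℝ) : EuclideanSpace ℝ (Fin 2) := (EuclideanSpace.equiv (Fin 2) ℝ).symm ![a, b]

/-- `σ̄(ξ,η) = ξ₃η_h − η₃ξ_h ∈ ℝ²`. -/
def sigmaBar (ξ η : E3) : EuclideanSpace ℝ (Fin 2) :=
  vec2 (ξ 2 * η 0 - η 2 * ξ 0) (ξ 2 * η 1 - η 2 * ξ 1)

/-- `2^{k−1} ≤ |ξ| ≤ 2^{k+1}`. -/
def DyadicK (ξ : E3) (k : ℤ) : Prop := (2:ℝ)^(k-1) ≤ ‖ξ‖ ∧ ‖ξ‖ ≤ (2:ℝ)^(k+1)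

/-- `2^{p−1} ≤ √(1−Λ(ξ)²) ≤ 2^{p+1}`. -/
def DyadicP (ξ : E3) (p : ℤ) : Prop :=
  (2:ℝ)^(p-1) ≤ Real.sqrt (1 - (Lam ξ)^2) ∧ Real.sqrt (1 - (Lam ξ)^2) ≤ (2:ℝ)^(p+1)

/-- `2^{q−1} ≤ |Λ(ξ)| ≤ 2^{q+1}`. -/
def DyadicQ (ξ : E3) (q : ℤ) : Prop := (2:ℝ)^(q-1) ≤ |Lam ξ| ∧ |Lam ξ| ≤ (2:ℝ)^(q+1)


/-- A standard bump function `ψ`: smooth, supported in `[−2,2]`, valued in `[0,1]`,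
equal to `1` on `[−1,1]`, nonincreasing on `[0,∞)`. -/
structure IsCutoff (ψ : ℝ → ℝ) : Prop where
  smooth : ContDiff ℝ (⊤ : ℕ∞) ψ
  supp : ∀ x : ℝ, 2 < |x| → ψ x = 0
  mem01 : ∀ x : ℝ, ψ x ∈ Set.Icc (0:ℝ) 1
  one_on : ∀ x : ℝ, |x| ≤ 1 → ψ x = 1
  anti : AntitoneOn ψ (Set.Ici 0)

/-- `φ(x) = ψ(x) − ψ(2x)`. -/
def cphi (ψ : ℝ → ℝ) (x : ℝ) : ℝ := ψ x - ψ (2*x)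

/-- `φ_k(ξ) = φ(2^{−k}|ξ|)`. -/
def phiK (ψ : ℝ → ℝ) (k : ℤ) (ξ : E3) : ℝ := cphi ψ ((2:ℝ)^(-k) * ‖ξ‖)

/-- `φ_{k,p}(ξ) = φ_k(ξ)·φ(2^{−p}√(1−Λ(ξ)²))`. -/
def phiKP (ψ : ℝ → ℝ) (k p : ℤ) (ξ : E3) : ℝ :=
  phiK ψ k ξ * cphi ψ ((2:ℝ)^(-p) * Real.sqrt (1 - (Lam ξ)^2))

/-- `φ_{k,p,q}(ξ) = φ_{k,p}(ξ)·φ(2^{−q}Λ(ξ))`. -/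
def phiKPQ (ψ : ℝ → ℝ) (k p q : ℤ) (ξ : E3) : ℝ :=
  phiKP ψ k p ξ * cphi ψ ((2:ℝ)^(-q) * Lam ξ)

/-- Littlewood–Paley projection `P_k`. -/
def Pk (ψ : ℝ → ℝ) (k : ℤ) (f : E3 → ℂ) : E3 → ℂ := fmul (fun ξ => (phiK ψ k ξ : ℂ)) f

/-- Localization `P_{k,p}`. -/
def Pkp (ψ : ℝ → ℝ) (k p : ℤ) (f : E3 → ℂ) : E3 → ℂ := fmul (fun ξ => (phiKP ψ k p ξ : ℂ)) f

/-- Localization `P_{k,p,q}`. -/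
def Pkpq (ψ : ℝ → ℝ) (k p q : ℤ) (f : E3 → ℂ) : E3 → ℂ :=
  fmul (fun ξ => (phiKPQ ψ k p q ξ : ℂ)) f

/-- Legendre polynomial `L_n(x) = (1/(2^n n!)) (d/dx)^n (x²−1)^n`. -/
def legendreP (n : ℕ) : Polynomial ℝ :=
  Polynomial.C (1 / ((2:ℝ)^n * (n.factorial : ℝ))) *
    (fun q => Polynomial.derivative q)^[n] ((Polynomial.X^2 - 1)^n)

/-- `𝔷_n(x) = ((2n+1)/(4π)) L_n(x)`. -/
def zleg (n : ℕ) (x : ℝ) : ℝ := ((2*(n:ℝ)+1) / (4*Real.pi)) * (legendreP n).eval x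

/-- Spherical coordinates point on the unit sphere. -/
def sphPt (a b : ℝ) : E3 := vec3 (Real.sin a * Real.cos b) (Real.sin a * Real.sin b) (Real.cos a)

/-- Surface integral over the unit sphere `S² ⊂ ℝ³`. -/
def sphereIntegral (g : E3 → ℂ) : ℂ :=
  ∫ a in (0:ℝ)..Real.pi, ∫ b in (0:ℝ)..(2*Real.pi), (Real.sin a : ℂ) * g (sphPt a b)

/-- Angular localization `R̄_{≤l}`. -/
def RbarLe (ψ : ℝ → ℝ) (l : ℤ) (f : E3 → ℂ) : E3 → ℂ := fun x =>
  ∑' n : ℕ, ((ψ ((2:ℝ)^(-l) * (n:ℝ)) : ℝ) : ℂ) *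
    sphereIntegral (fun θ => f (‖x‖ • θ) * ((zleg n ⟪θ, ‖x‖⁻¹ • x⟫ : ℝ) : ℂ))

/-- Angular localization `R̄_l`. -/
def Rbar (ψ : ℝ → ℝ) (l : ℤ) (f : E3 → ℂ) : E3 → ℂ := fun x =>
  ∑' n : ℕ, ((cphi ψ ((2:ℝ)^(-l) * (n:ℝ)) : ℝ) : ℂ) *
    sphereIntegral (fun θ => f (‖x‖ • θ) * ((zleg n ⟪θ, ‖x‖⁻¹ • x⟫ : ℝ) : ℂ))

/-- Angular localization `R_l`, relative to the index `p`. -/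
def Rl (ψ : ℝ → ℝ) (p l : ℤ) (f : E3 → ℂ) : E3 → ℂ :=
  if p + l < 0 then 0 else if p + l = 0 then RbarLe ψ l f else Rbar ψ l f

/-- `2^x` as an extended nonnegative real. -/
def twoPow (x : ℝ) : ℝ≥0∞ := ENNReal.ofReal ((2:ℝ) ^ x)

/-- `k⁺ = max(k,0)` as a real number. -/
def kplus (k : ℤ) : ℝ := max (k:ℝ) 0

/-- `k⁻ = min(k,0)` as a real number. -/
def kminus (k : ℤ) : ℝ := min (k:ℝ) 0

/-- The `B` norm. -/
def Bnorm (ψ : ℝ → ℝ) (f : E3 → ℂ) : ℝ≥0∞ :=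
  ⨆ (k : ℤ) (p : ℤ) (q : ℤ) (_ : p ≤ 0) (_ : q ≤ 0),
    twoPow (3 * kplus k - kminus k / 2 - (p:ℝ) - (q:ℝ)/2) * eLpNorm (Pkpq ψ k p q f) 2 volume

/-- The `X` norm. -/
def Xnorm (ψ : ℝ → ℝ) (β : ℝ) (f : E3 → ℂ) : ℝ≥0∞ :=
  ⨆ (k : ℤ) (p : ℤ) (l : ℤ) (_ : p ≤ 0) (_ : 0 ≤ l) (_ : 0 ≤ p + l),
    twoPow (3 * kplus k + (1+β) * (l:ℝ) + β * (p:ℝ)) *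
      eLpNorm (Pkp ψ k p (Rl ψ p l f)) 2 volume

/-- Horizontal curl `curl_h v = ∂₁v₂ − ∂₂v₁`. -/
def curlH (v : E3 → E3) : E3 → ℝ := fun x => pd (fun y => v y 1) 0 x - pd (fun y => v y 0) 1 x

/-- `A = |∇_h|⁻¹ curl_h(v)`. -/
def dispA (v : E3 → E3) : E3 → ℂ :=
  fmul (fun ξ => (((horNorm ξ)⁻¹ : ℝ) : ℂ)) (fun x => ((curlH v x : ℝ) : ℂ))

/-- `C = |∇||∇_h|⁻¹ v₃`. -/
def dispC (v : E3 → E3) : E3 → ℂ :=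
  fmul (fun ξ => ((‖ξ‖ * (horNorm ξ)⁻¹ : ℝ) : ℂ)) (fun x => ((v x 2 : ℝ) : ℂ))

/-- Dispersive unknowns `U_± = A ± C` (`sgn = ±1`). -/
def dispU (sgn : ℝ) (v : E3 → E3) : E3 → ℂ := fun x => dispA v x + (sgn : ℂ) * dispC v x

/-- Profiles `𝒰_±(t) = e^{∓itΛ} U_±(t)`. -/
def profile (sgn : ℝ) (u : ℝ → E3 → E3) (t : ℝ) : E3 → ℂ :=
  fmul (fun ξ => Complex.exp (-(Complex.I * ((sgn * t * Lam ξ : ℝ) : ℂ)))) (dispU sgn (u t))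

/-- Rotation by angle `θ` about the `x₃`-axis. -/
def rotZ (θ : ℝ) (x : E3) : E3 :=
  vec3 (Real.cos θ * x 0 - Real.sin θ * x 1) (Real.sin θ * x 0 + Real.cos θ * x 1) (x 2)

/-- Axisymmetry of a vector field. -/
def Axisymmetric (v : E3 → E3) : Prop := ∀ θ x, v (rotZ θ x) = rotZ θ (v x)

/-- The initial condition (IC) with parameters `(M,N,N₀,β,ε)`, imposed on the dispersive
unknowns `U₀^±` of the initial velocity. -/
def SatisfiesIC (ψ : ℝ → ℝ) (M N N₀ : ℕ) (β ε : ℝ) (u₀ : E3 → E3) : Prop :=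
  ∀ sgn ∈ pmSet,
    (HmNorm (2*N₀) (dispU sgn u₀) + HdotNeg1Norm (dispU sgn u₀) ≤ ε) ∧
    (∀ a ≤ M, L2norm (SscalIter a (dispU sgn u₀))
        + HdotNeg1Norm (SscalIter a (dispU sgn u₀)) ≤ ε) ∧
    (∀ b ≤ N, Bnorm ψ (SscalIter b (dispU sgn u₀)) + Xnorm ψ β (SscalIter b (dispU sgn u₀))
        ≤ ENNReal.ofReal ε)

/-- The bootstrap assumption (BA) with constant `c` on `[0,T]`. -/
def SatisfiesBA (ψ : ℝ → ℝ) (N : ℕ) (β c ε T : ℝ) (u : ℝ → E3 → E3) : Prop :=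
  ∀ sgn ∈ pmSet, ∀ n ≤ N, ∀ t ∈ Set.Icc (0:ℝ) T,
    Bnorm ψ (SscalIter n (profile sgn u t)) + Xnorm ψ β (SscalIter n (profile sgn u t))
      ≤ ENNReal.ofReal (c * ε)

/-- The constraints on the parameters of the main theorem:
`N₀ ≫ M ≫ N`, `β > 0`, `β⁻¹ ≥ 60`, `β⁻¹ ≤ M`, `ε > 0`. -/
def GoodParams (M N N₀ : ℕ) (β ε : ℝ) : Prop :=
  N < M ∧ M < N₀ ∧ 0 < β ∧ 60 ≤ β⁻¹ ∧ β⁻¹ ≤ (M:ℝ) ∧ 0 < ε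

/-- Choices `ζ ∈ {ξ, ξ−η, η}`. -/
def zChoices : Set (E3 → E3 → E3) := {fun ξ _ => ξ, fun ξ η => ξ - η, fun _ η => η}

/-- Choices `θ ∈ {ξ−η, η}`. -/
def thChoices : Set (E3 → E3 → E3) := {fun ξ η => ξ - η, fun _ η => η}

/-- Horizontal dot product `a_h · b_h`. -/
def horDot (a b : E3) : ℝ := a 0 * b 0 + a 1 * b 1

/-- `a_h^⊥ · b_h`. -/
def horDotPerp (a b : E3) : ℝ := -(a 1) * b 0 + a 0 * b 1

/-- The elementary class `Ē` of multiplier factors. -/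
def EbarFns : Set (E3 × E3 → ℝ) :=
  {g | (∃ ζ ∈ zChoices, g = fun v => Lam (ζ v.1 v.2)) ∨
       (∃ ζ ∈ zChoices, g = fun v => Real.sqrt (1 - (Lam (ζ v.1 v.2))^2)) ∨
       (∃ θf ∈ thChoices,
          g = fun v => horDot v.1 (θf v.1 v.2) / (horNorm v.1 * horNorm (θf v.1 v.2))) ∨
       (∃ θf ∈ thChoices,
          g = fun v => horDotPerp v.1 (θf v.1 v.2) / (horNorm v.1 * horNorm (θf v.1 v.2)))}

/-- Generators `Λ(ζ₁)√(1−Λ(ζ₂)²)·n̄(ξ,η)`. -/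
def genFns : Set (E3 × E3 → ℝ) :=
  {g | ∃ ζ₁ ∈ zChoices, ∃ ζ₂ ∈ zChoices, ∃ nb ∈ EbarFns,
        g = fun v => Lam (ζ₁ v.1 v.2) * Real.sqrt (1 - (Lam (ζ₂ v.1 v.2))^2) * nb v}

/-- Admissible multiplier: `𝔪 = |ξ|·𝔫₀` with `𝔫₀` a finite linear combination of generators. -/
def IsAdmissibleMultiplier (mm : E3 → E3 → ℂ) : Prop :=
  ∃ n₀ ∈ Submodule.span ℝ genFns, mm = fun ξ η => (((‖ξ‖ * n₀ (ξ, η)) : ℝ) : ℂ)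

/-- The bilinear expression `Q_𝔪(f₁,f₂)(s)`. -/
def Qm (Φ : E3 → E3 → ℝ) (mm : E3 → E3 → ℂ) (f₁ f₂ : ℝ → E3 → ℂ) (s : ℝ) : E3 → ℂ :=
  𝓕⁻ (fun ξ => ∫ η : E3,
    Complex.exp (Complex.I * ((s * Φ ξ η : ℝ) : ℂ)) * mm ξ η * 𝓕 (f₁ s) (ξ - η) * 𝓕 (f₂ s) η)

/-- The bilinear term `B_𝔪(f₁,f₂)(t) = ∫₀ᵗ e^{(t−s)κΔ} Q_𝔪(f₁,f₂)(s) ds`. -/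
def Bm (κ : ℝ) (Φ : E3 → E3 → ℝ) (mm : E3 → E3 → ℂ) (f₁ f₂ : ℝ → E3 → ℂ) (t : ℝ) : E3 → ℂ :=
  fun x => ∫ s in (0:ℝ)..t, heatOp ((t - s) * κ) (Qm Φ mm f₁ f₂ s) x

/-- `(∂_t − κΔ)g` at time `t`. -/
def dtMinusKLap (κ : ℝ) (g : ℝ → E3 → ℂ) (t : ℝ) : E3 → ℂ :=
  fun x => deriv (fun s => g s x) t - κ • lap (g t) x

/-- Denominator appearing in the modified multiplier of the normal form. -/
def nfDenom (κ : ℝ) (a b : ℕ) (μ μ₁ μ₂ : ℝ) (ξ η : E3) : ℂ :=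
  Complex.I * ((Phase μ μ₁ μ₂ ξ η : ℝ) : ℂ) + ((κ * ‖ξ‖^2 : ℝ) : ℂ)
    - (((2*(a:ℝ)+1) * κ * ‖η‖^2 : ℝ) : ℂ) - (((2*(b:ℝ)+1) * κ * ‖ξ - η‖^2 : ℝ) : ℂ)

/-- The Fourier-side normal-form bilinear integral with the modified multiplier `𝔫`. -/
def nfInt (κ : ℝ) (a b : ℕ) (μ μ₁ μ₂ : ℝ) (mm : E3 → E3 → ℂ) (τ : ℝ → ℝ)
    (F₁ F₂ : ℝ → E3 → ℂ) (s : ℝ) (ξ : E3) : ℂ :=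
  ∫ η : E3, (τ s : ℂ) * Complex.exp (Complex.I * ((s * Phase μ μ₁ μ₂ ξ η : ℝ) : ℂ)) *
    (-(mm ξ η) / nfDenom κ a b μ μ₁ μ₂ ξ η) * 𝓕 (F₁ s) η * 𝓕 (F₂ s) (ξ - η)

-- STATEMENT 1
/-- `c_{n,k}`: the coefficient of `x^k` in `(x + 3/2)·(−1)^{n−k}·(x+3)^{n−k−1}·(x−2)^n`
for `k < n`, and `c_{n,n} = 1`. -/
def cCoef (n k : ℕ) : ℝ :=
  if k = n then 1 else
    ((Polynomial.X + Polynomial.C ((3:ℝ)/2)) * Polynomial.C ((-1:ℝ)^(n-k)) *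
      (Polynomial.X + Polynomial.C (3:ℝ))^(n-k-1) *
      (Polynomial.X - Polynomial.C (2:ℝ))^n).coeff k

/-- The polynomials `q_n` with `q_n (y) = ((y + 2x + 6)^n + (y - 2x)^n) / 2` for `y = -x(x+3)`. -/
def symmPoly : ℕ → Polynomial ℝ
  | 0 => 1
  | 1 => Polynomial.X + 3
  | n + 2 => (2 * Polynomial.X + 6) * symmPoly (n + 1)
      - (Polynomial.X ^ 2 + 10 * Polynomial.X) * symmPoly n

lemma two_mul_aeval_symmPoly {R : Type*} [CommRing R] [Algebra ℝ R] {x y : R}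
    (hy : y = -(x * (x + 3))) (n : ℕ) :
    2 * Polynomial.aeval y (symmPoly n) = (y + 2 * x + 6) ^ n + (y - 2 * x) ^ n := by
  induction n using symmPoly.induct with
  | case1 => simp [symmPoly]; norm_num
  | case2 =>
    simp only [symmPoly, map_add, Polynomial.aeval_X, map_ofNat]
    ring
  | case3 n ih1 ih2 =>
    have h : 2 * Polynomial.aeval y (symmPoly (n + 2)) =
        (2 * y + 6) * (2 * Polynomial.aeval y (symmPoly (n + 1)))
          - (y ^ 2 + 10 * y) * (2 * Polynomial.aeval y (symmPoly n)) := by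
      simp only [symmPoly, map_add, map_sub, map_mul, map_pow, Polynomial.aeval_X, map_ofNat]
      ring
    have h2 : y ^ 2 + 10 * y = (y + 2 * x + 6) * (y - 2 * x) := by
      rw [hy]; ring
    change 2 * Polynomial.aeval y (symmPoly (n + 2)) =
      (y + 2 * x + 6) ^ (n + 2) + (y - 2 * x) ^ (n + 2)
    rw [h, ih1, ih2, h2]
    ring

lemma cCoef_self (n : ℕ) : cCoef n n = 1 := by simp [cCoef]

lemma cCoef_of_lt {n k : ℕ} (h : k < n) :
    cCoef n k = ((Polynomial.X + Polynomial.C ((3:ℝ)/2)) * Polynomial.C ((-1:ℝ)^(n-k)) *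
      (Polynomial.X + Polynomial.C (3:ℝ))^(n-k-1) *
      (Polynomial.X - Polynomial.C (2:ℝ))^n).coeff k := by
  rw [cCoef, if_neg h.ne]

lemma cCoef_succ_self (m : ℕ) : cCoef (m + 1) m = 5 * (m + 1) - 2 * (m + 1) ^ 2 := by
  rw [cCoef_of_lt (Nat.lt_succ_self m)]
  have h : ∀ p : Polynomial ℝ, ((Polynomial.X + Polynomial.C ((3:ℝ)/2)) *
      Polynomial.C ((-1:ℝ)^(m+1-m)) * (Polynomial.X + Polynomial.C (3:ℝ))^(m+1-m-1) * p)
      = -(Polynomial.X * p) - Polynomial.C (3/2) * p := by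
    intro p
    simp
    ring
  rw [h]
  cases m with
  | zero => simp; norm_num
  | succ m =>
    simp only [Polynomial.coeff_sub, Polynomial.coeff_neg, Polynomial.coeff_X_mul,
      Polynomial.coeff_C_mul]
    rw [sub_eq_add_neg Polynomial.X, ← Polynomial.C_neg]
    simp only [Polynomial.coeff_X_add_C_pow, Nat.succ_eq_add_one]
    have h1 : m + 1 + 1 - m = 2 := by omega
    have h2 : m + 1 + 1 - (m + 1) = 1 := by omega
    rw [h1, h2, Nat.choose_succ_self_right, Nat.choose_symm_of_eq_add (b := 2) (by omega),
      Nat.cast_choose_two]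
    push_cast
    ring

/-- The recurrence of the coefficients strictly below the diagonal. -/
lemma coeff_recurrence (Q : Polynomial ℝ) (k : ℕ) :
    ((Q * ((Polynomial.X + 3) * (Polynomial.X - 2) ^ 2)).coeff k) =
      2 * (Q * (Polynomial.X * (Polynomial.X + 3) * (Polynomial.X - 2))).coeff k
      - 6 * (Q * (Polynomial.X - 2)).coeff k
      - (Q * (Polynomial.X ^ 2 * (Polynomial.X + 3))).coeff k
      + 10 * (Q * Polynomial.X).coeff k := by
  simp only [← Polynomial.coeff_C_mul, ← Polynomial.coeff_sub, ← Polynomial.coeff_add]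
  congr 1
  simp only [map_ofNat]
  ring

lemma coeff_symmPoly (n k : ℕ) :
    (symmPoly n).coeff k = if k ≤ n then cCoef n k else 0 := by
  induction n using symmPoly.induct generalizing k with
  | case1 =>
    rcases k with _ | k
    · simp [symmPoly, cCoef]
    · simp [symmPoly, Polynomial.coeff_one]
  | case2 =>
    rcases k with _ | _ | k
    · have := cCoef_succ_self 0
      simp at this
      simp [symmPoly, this]; norm_num
    · simp [symmPoly, cCoef, Polynomial.coeff_X, Polynomial.coeff_ofNat_succ]
    · simp [symmPoly, Polynomial.coeff_X, Polynomial.coeff_ofNat_succ]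
  | case3 n ih1 ih2 =>
    have h : symmPoly (n + 2) = Polynomial.C 2 * (Polynomial.X * symmPoly (n + 1))
        + Polynomial.C 6 * symmPoly (n + 1) - Polynomial.X * (Polynomial.X * symmPoly n)
        - Polynomial.C 10 * (Polynomial.X * symmPoly n) := by
      simp only [symmPoly, map_ofNat]; ring
    rw [h]
    simp only [Polynomial.coeff_sub, Polynomial.coeff_add, Polynomial.coeff_C_mul]
    rcases lt_trichotomy k (n + 1) with hk | hk | hk
    · obtain ⟨d, rfl⟩ := Nat.exists_eq_add_of_le (Nat.lt_succ_iff.mp hk)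
      set Q : Polynomial ℝ := (Polynomial.X + Polynomial.C ((3:ℝ)/2)) * Polynomial.C ((-1:ℝ)^d) *
        (Polynomial.X + 3) ^ d * (Polynomial.X - 2) ^ (k + d) with hQ
      have hr := coeff_recurrence Q k
      have e0 : cCoef (k + d + 2) k =
          (Q * ((Polynomial.X + 3) * (Polynomial.X - 2) ^ 2)).coeff k := by
        rw [cCoef_of_lt (by omega)]
        congr 1
        rw [show k + d + 2 - k = d + 2 by omega, show d + 2 - 1 = d + 1 by omega, hQ]
        simp only [map_ofNat, pow_add, map_mul]
        simp
        ring
      have e2 : cCoef (k + d + 1) k = -(Q * (Polynomial.X - 2)).coeff k := by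
        rw [cCoef_of_lt (by omega), ← Polynomial.coeff_neg]
        congr 1
        rw [show k + d + 1 - k = d + 1 by omega, show d + 1 - 1 = d by omega, hQ]
        simp only [map_ofNat, pow_add, map_mul]
        simp
        ring
      have e1 : (Polynomial.X * symmPoly (k + d + 1)).coeff k =
          (Q * (Polynomial.X * (Polynomial.X + 3) * (Polynomial.X - 2))).coeff k := by
        rw [show Q * (Polynomial.X * (Polynomial.X + 3) * (Polynomial.X - 2)) =
          Polynomial.X * (Q * ((Polynomial.X + 3) * (Polynomial.X - 2))) by ring]
        rcases k with _ | k
        · simp only [Polynomial.mul_coeff_zero, Polynomial.coeff_X_zero,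
            zero_mul]
        rw [Polynomial.coeff_X_mul, Polynomial.coeff_X_mul, ih1, if_pos (by omega),
          cCoef_of_lt (by omega)]
        congr 1
        rw [show k + 1 + d + 1 - k = d + 2 by omega, show d + 2 - 1 = d + 1 by omega, hQ]
        simp only [map_ofNat, pow_add, map_mul]
        simp
        ring
      have e4 : (Polynomial.X * symmPoly (k + d)).coeff k = -(Q * Polynomial.X).coeff k := by
        rw [mul_comm Q]
        rcases k with _ | k
        · simp only [Polynomial.mul_coeff_zero, Polynomial.coeff_X_zero,
            zero_mul, neg_zero]
        rw [Polynomial.coeff_X_mul, Polynomial.coeff_X_mul, ih2, if_pos (by omega),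
          cCoef_of_lt (by omega), ← Polynomial.coeff_neg]
        congr 1
        rw [show k + 1 + d - k = d + 1 by omega, show d + 1 - 1 = d by omega, hQ]
        simp only [map_ofNat, pow_add, map_mul]
        simp
      have e3 : (Polynomial.X * (Polynomial.X * symmPoly (k + d))).coeff k =
          (Q * (Polynomial.X ^ 2 * (Polynomial.X + 3))).coeff k := by
        rw [show Q * (Polynomial.X ^ 2 * (Polynomial.X + 3)) =
          Polynomial.X * (Polynomial.X * (Q * (Polynomial.X + 3))) by ring]
        rcases k with _ | _ | k
        · simp only [Polynomial.mul_coeff_zero, Polynomial.coeff_X_zero,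
            zero_mul]
        · simp only [Polynomial.coeff_X_mul, Polynomial.mul_coeff_zero, Polynomial.coeff_X_zero,
            zero_mul]
        rw [Polynomial.coeff_X_mul, Polynomial.coeff_X_mul, Polynomial.coeff_X_mul,
          Polynomial.coeff_X_mul, ih2, if_pos (by omega), cCoef_of_lt (by omega)]
        congr 1
        rw [show k + 1 + 1 + d - k = d + 2 by omega, show d + 2 - 1 = d + 1 by omega, hQ]
        simp only [map_ofNat, pow_add, map_mul]
        simp
        ring
      rw [e1, e3, e4, ih1, if_pos (by omega), if_pos (by omega), e0, e2, hr]
      ring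
    · subst hk
      rw [if_pos (by omega), cCoef_succ_self (n + 1)]
      simp only [Polynomial.coeff_X_mul, ih1, ih2]
      rw [if_pos (by omega), if_pos le_rfl, if_pos le_rfl, cCoef_self, cCoef_succ_self, cCoef_self]
      rcases n with _ | n
      · simp; norm_num
      · rw [Polynomial.coeff_X_mul, ih2, if_pos (by omega), cCoef_succ_self]
        push_cast
        ring
    · obtain ⟨d, rfl⟩ := Nat.exists_eq_add_of_lt hk
      rw [show n + 1 + d + 1 = (n + d) + 1 + 1 by omega]
      simp only [Polynomial.coeff_X_mul, ih1, ih2]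
      rcases d with _ | d
      · simp [cCoef_self]; norm_num
      · simp

lemma symmPoly_eq_sum (n : ℕ) :
    symmPoly n = ∑ k ∈ Finset.range (n + 1), Polynomial.C (cCoef n k) * Polynomial.X ^ k := by
  ext k
  simp [coeff_symmPoly, Polynomial.coeff_X_pow]

/-- If `S` satisfies `S + S* = -3` for a symmetric bilinear form, then
`G (S^n u) ((S-2)^n u)` is a combination of the `G (S^k u) (S^k u)`. -/
lemma bilin_pow_eq_sum {V : Type*} [AddCommGroup V] [Module ℝ V] (S : Module.End ℝ V)
    (G : V →ₗ[ℝ] V →ₗ[ℝ] ℝ) (hsymm : ∀ a b, G a b = G b a)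
    (hskew : ∀ a b, G (S a) b = -G a (S b) - 3 * G a b) (n : ℕ) (u : V) :
    G ((S ^ n) u) (((S - 2) ^ n) u) =
      ∑ k ∈ Finset.range (n + 1), cCoef n k * G ((S ^ k) u) ((S ^ k) u) := by
  set Y : Polynomial ℝ := -3 - Polynomial.X with hY
  have adj : ∀ (p : Polynomial ℝ) (a b : V),
      G (Polynomial.aeval S p a) b = G a (Polynomial.aeval S (p.comp Y) b) := by
    intro p
    induction p using Polynomial.induction_on' with
    | add p r hp hr => intro a b; simp [hp, hr]
    | monomial m c =>
      rw [← Polynomial.C_mul_X_pow_eq_monomial]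
      induction m with
      | zero => intro a b; simp
      | succ m ih =>
        intro a b
        have : Polynomial.aeval S (Polynomial.C c * Polynomial.X ^ (m + 1)) a =
            Polynomial.aeval S (Polynomial.C c * Polynomial.X ^ m) (S a) := by
          simp [pow_succ]
        rw [this, ih, hskew]
        have hcomp : (Polynomial.C c * Polynomial.X ^ (m + 1)).comp Y =
            Y * (Polynomial.C c * Polynomial.X ^ m).comp Y := by
          simp only [Polynomial.mul_comp, Polynomial.C_comp, Polynomial.X_pow_comp,
            Polynomial.X_comp, pow_succ]
          ring
        rw [hcomp, map_mul, Module.End.mul_apply]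
        simp only [hY, map_sub, map_neg, Polynomial.aeval_X, LinearMap.sub_apply,
          LinearMap.neg_apply, map_ofNat, Module.End.ofNat_apply, map_nsmul]
        simp
        ring
  have L : ∀ p : Polynomial ℝ, G u (Polynomial.aeval S p u) =
      G u (Polynomial.aeval S (p.comp Y) u) := fun p => by rw [← adj, hsymm]
  have pair : ∀ p r : Polynomial ℝ, G (Polynomial.aeval S p u) (Polynomial.aeval S r u) =
      G u (Polynomial.aeval S (p.comp Y * r) u) := fun p r => by
    rw [adj, map_mul, Module.End.mul_apply]
  have hS : ∀ k, (S ^ k) u = Polynomial.aeval S ((Polynomial.X : Polynomial ℝ) ^ k) u := by simp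
  have hS2 : ((S - 2) ^ n) u = Polynomial.aeval S ((Polynomial.X - 2 : Polynomial ℝ) ^ n) u := by
    simp only [map_pow, map_sub, Polynomial.aeval_X, map_ofNat]
  have key := two_mul_aeval_symmPoly (x := (Polynomial.X : Polynomial ℝ)) (y := Y * Polynomial.X)
    (by rw [hY]; ring) n
  simp only [hS, hS2, pair]
  have h2 : 2 * G u (Polynomial.aeval S
      (((Polynomial.X : Polynomial ℝ) ^ n).comp Y * (Polynomial.X - 2) ^ n) u) =
      2 * G u (Polynomial.aeval S (Polynomial.aeval (Y * Polynomial.X) (symmPoly n)) u) := by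
    calc _ = G u (Polynomial.aeval S ((Polynomial.X ^ n).comp Y * (Polynomial.X - 2) ^ n
            + ((Polynomial.X ^ n).comp Y * (Polynomial.X - 2) ^ n).comp Y) u) := by
          rw [map_add, LinearMap.add_apply, map_add, ← L, two_mul]
      _ = G u (Polynomial.aeval S
            (2 * Polynomial.aeval (Y * Polynomial.X) (symmPoly n)) u) := by
          rw [key]
          congr 3
          simp only [Polynomial.mul_comp, Polynomial.pow_comp, Polynomial.X_comp,
            Polynomial.sub_comp, Polynomial.ofNat_comp, ← mul_pow, hY, Polynomial.neg_comp]
          congr 2 <;> ring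
      _ = _ := by
          rw [two_mul, map_add, LinearMap.add_apply, map_add, two_mul]
  rw [mul_left_cancel₀ two_ne_zero h2, symmPoly_eq_sum]
  simp only [map_sum, LinearMap.sum_apply]
  refine Finset.sum_congr rfl fun k _ => ?_
  simp [mul_pow, Module.algebraMap_end_apply]
open scoped LineDeriv Laplacian

/-- The radial derivative `(x·∇)v` of a Schwartz vector field. -/
def radialDeriv : SchwartzMap E3 E3 →L[ℝ] SchwartzMap E3 E3 :=
  (SchwartzMap.bilinLeftCLM (ContinuousLinearMap.id ℝ (E3 →L[ℝ] E3))
    Function.HasTemperateGrowth.id').comp (SchwartzMap.fderivCLM ℝ E3 E3)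

lemma radialDeriv_apply (v : SchwartzMap E3 E3) (x : E3) :
    radialDeriv v x = fderiv ℝ v x x := rfl

/-- The scaling vector field as an endomorphism of the Schwartz vector fields. -/
def scaling : Module.End ℝ (SchwartzMap E3 E3) := (radialDeriv : _ →ₗ[ℝ] _) - 1

lemma scaling_eq (v : SchwartzMap E3 E3) : scaling v = radialDeriv v - v := rfl

lemma coe_scaling (v : SchwartzMap E3 E3) : ⇑(scaling v) = Svec v := rfl

lemma coe_scaling_pow (n : ℕ) (v : SchwartzMap E3 E3) :
    ⇑((scaling ^ n) v) = Svec^[n] v := by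
  induction n with
  | zero => rfl
  | succ n ih => rw [pow_succ', Module.End.mul_apply, coe_scaling, ih, Function.iterate_succ_apply']

lemma lineDerivOp_scaling (e : E3) (v : SchwartzMap E3 E3) :
    ∂_{e} (scaling v) = scaling (∂_{e} v) + ∂_{e} v := by
  ext1 x
  have h1 : HasFDerivAt (fun y => fderiv ℝ v y) (fderiv ℝ (fderiv ℝ v) x) x :=
    (((v.smooth 2).fderiv_right (m := 1) (by norm_num)).differentiable (by norm_num) x).hasFDerivAt
  have h2 : HasFDerivAt (fun y => fderiv ℝ v y y - v y) _ x :=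
    (h1.clm_apply (hasFDerivAt_id x)).sub (v.hasFDerivAt x)
  have h3 : HasFDerivAt (fun y => fderiv ℝ v y e) _ x := h1.clm_apply (hasFDerivAt_const e x)
  have hs : IsSymmSndFDerivAt ℝ v x :=
    (v.contDiffAt 2).isSymmSndFDerivAt (by simp)
  have hv : ∀ y, (∂_{e} v) y = fderiv ℝ v y e := fun y =>
    SchwartzMap.lineDerivOp_apply_eq_fderiv e v y
  rw [SchwartzMap.lineDerivOp_apply_eq_fderiv, add_apply, coe_scaling, coe_scaling]
  unfold Svec
  rw [h2.fderiv, funext hv, h3.fderiv]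
  simp [hs.eq x e]

lemma laplacian_scaling (v : SchwartzMap E3 E3) :
    Δ (scaling v) = scaling (Δ v) + (2:ℝ) • Δ v := by
  simp only [SchwartzMap.laplacian_eq_sum (EuclideanSpace.basisFun (Fin 3) ℝ),
    lineDerivOp_scaling, LineDeriv.lineDerivOp_add, map_sum, Finset.sum_add_distrib, two_smul]
  abel

lemma scaling_laplacian (v : SchwartzMap E3 E3) :
    scaling (Δ v) = Δ ((scaling - 2) v) := by
  have h : (scaling - 2) v = scaling v - (2:ℝ) • v := by
    simp [two_smul, Module.End.ofNat_apply]
  rw [h, ← SchwartzMap.laplacianCLM_eq ℝ (scaling v - (2:ℝ) • v), map_sub, map_smul,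
    SchwartzMap.laplacianCLM_eq, SchwartzMap.laplacianCLM_eq, laplacian_scaling]
  abel

lemma scaling_pow_laplacian (n : ℕ) (v : SchwartzMap E3 E3) :
    (scaling ^ n) (Δ v) = Δ (((scaling - 2) ^ n) v) := by
  induction n with
  | zero => rfl
  | succ n ih =>
    rw [pow_succ', Module.End.mul_apply, ih, scaling_laplacian, pow_succ', Module.End.mul_apply]

lemma coe_laplacian (v : SchwartzMap E3 E3) : ⇑(Δ v : SchwartzMap E3 E3) = lap v := by
  ext1 x
  rw [SchwartzMap.laplacian_eq_sum (EuclideanSpace.basisFun (Fin 3) ℝ)]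
  simp only [sum_apply, EuclideanSpace.basisFun_apply]
  rfl

lemma integrable_inner (a b : SchwartzMap E3 E3) : Integrable fun x => ⟪a x, b x⟫ :=
  (SchwartzMap.pairing (innerSL ℝ) a b).integrable

/-- The coordinate multiplication operator `v ↦ x_k v`. -/
def coordMul (k : Fin 3) : SchwartzMap E3 E3 →L[ℝ] SchwartzMap E3 E3 :=
  SchwartzMap.smulLeftCLM E3 fun x : E3 => x k

lemma coordMul_apply (k : Fin 3) (v : SchwartzMap E3 E3) (x : E3) :
    coordMul k v x = x k • v x :=
  SchwartzMap.smulLeftCLM_apply_apply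
    ((EuclideanSpace.proj k : E3 →L[ℝ] ℝ).hasTemperateGrowth) v x

lemma radialDeriv_eq_sum (v : SchwartzMap E3 E3) :
    radialDeriv v = ∑ k, coordMul k (∂_{ebasis k} v) := by
  ext1 x
  simp only [radialDeriv_apply, sum_apply, coordMul_apply,
    SchwartzMap.lineDerivOp_apply_eq_fderiv, ← map_smul, ← map_sum]
  congr 1
  ext i
  simp [ebasis, Fin.sum_univ_three]
  fin_cases i <;> simp

lemma lineDerivOp_coordMul (k : Fin 3) (v : SchwartzMap E3 E3) :
    ∂_{ebasis k} (coordMul k v) = coordMul k (∂_{ebasis k} v) + v := by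
  ext1 x
  have h : HasFDerivAt (fun y : E3 => y k • v y) _ x :=
    ((EuclideanSpace.proj k : E3 →L[ℝ] ℝ).hasFDerivAt (x := x)).smul (v.hasFDerivAt x)
  have hadd : (coordMul k (∂_{ebasis k} v) + v) x = x k • fderiv ℝ v x (ebasis k) + v x := by
    rw [add_apply, coordMul_apply, SchwartzMap.lineDerivOp_apply_eq_fderiv]
  rw [SchwartzMap.lineDerivOp_apply_eq_fderiv, funext (coordMul_apply k v), h.fderiv, hadd]
  simp [ebasis]

lemma integral_inner_lineDerivOp (a b : SchwartzMap E3 E3) (e : E3) :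
    ∫ x, ⟪∂_{e} a x, b x⟫ = -∫ x, ⟪a x, ∂_{e} b x⟫ := by
  have : ∫ x, ⟪a x, ∂_{e} b x⟫ = -∫ x, ⟪∂_{e} a x, b x⟫ :=
    SchwartzMap.integral_bilinear_lineDerivOp_right_eq_neg_left a b (innerSL ℝ) e
  rw [this, neg_neg]

lemma integral_inner_radialDeriv (a b : SchwartzMap E3 E3) :
    ∫ x, ⟪radialDeriv a x, b x⟫ =
      -(∫ x, ⟪a x, radialDeriv b x⟫) - 3 * ∫ x, ⟪a x, b x⟫ := by
  have h : ∀ k : Fin 3, ∫ x, ⟪coordMul k (∂_{ebasis k} a) x, b x⟫ =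
      -(∫ x, ⟪a x, coordMul k (∂_{ebasis k} b) x⟫) - ∫ x, ⟪a x, b x⟫ := by
    intro k
    have h1 : ∀ x, ⟪coordMul k (∂_{ebasis k} a) x, b x⟫ = ⟪(∂_{ebasis k} a) x, coordMul k b x⟫ := by
      intro x
      rw [coordMul_apply, coordMul_apply, real_inner_smul_left, real_inner_smul_right]
    simp_rw [h1]
    rw [integral_inner_lineDerivOp, lineDerivOp_coordMul]
    simp only [add_apply, inner_add_right]
    rw [integral_add (integrable_inner _ _) (integrable_inner _ _)]
    ring
  simp only [radialDeriv_eq_sum, sum_apply, sum_inner, inner_sum]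
  rw [integral_finsetSum _ fun _ _ => integrable_inner _ _,
    integral_finsetSum _ fun _ _ => integrable_inner _ _]
  simp only [h, Finset.sum_sub_distrib, Finset.sum_neg_distrib, Finset.sum_const]
  simp

lemma integral_inner_scaling (a b : SchwartzMap E3 E3) :
    ∫ x, ⟪scaling a x, b x⟫ = -(∫ x, ⟪a x, scaling b x⟫) - 5 * ∫ x, ⟪a x, b x⟫ := by
  simp only [scaling_eq, sub_apply, inner_sub_left, inner_sub_right]
  rw [integral_sub (integrable_inner _ _) (integrable_inner _ _),
    integral_sub (integrable_inner _ _) (integrable_inner _ _), integral_inner_radialDeriv]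
  ring

/-- The Dirichlet form `(a, b) ↦ -⟨a, Δb⟩_{L²}` on Schwartz vector fields. -/
def dirichletForm : SchwartzMap E3 E3 →ₗ[ℝ] SchwartzMap E3 E3 →ₗ[ℝ] ℝ :=
  LinearMap.mk₂ ℝ (fun a b => -∫ x, ⟪a x, (Δ b) x⟫)
    (fun a a' b => by
      simp only [add_apply, inner_add_left]
      rw [integral_add (integrable_inner _ _) (integrable_inner _ _), neg_add])
    (fun c a b => by
      simp only [smul_apply, real_inner_smul_left]
      rw [integral_const_mul, smul_eq_mul, mul_neg])
    (fun a b b' => by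
      simp only [← SchwartzMap.laplacianCLM_eq ℝ, map_add, add_apply, inner_add_right]
      rw [integral_add (integrable_inner _ _) (integrable_inner _ _), neg_add])
    (fun c a b => by
      simp only [← SchwartzMap.laplacianCLM_eq ℝ, map_smul, smul_apply,
        real_inner_smul_right]
      rw [integral_const_mul, smul_eq_mul, mul_neg])

lemma dirichletForm_apply (a b : SchwartzMap E3 E3) :
    dirichletForm a b = -∫ x, ⟪a x, (Δ b) x⟫ := rfl

lemma dirichletForm_comm (a b : SchwartzMap E3 E3) :
    dirichletForm a b = dirichletForm b a := by
  have : ∫ x, ⟪a x, (Δ b) x⟫ = ∫ x, ⟪(Δ a) x, b x⟫ :=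
    SchwartzMap.integral_bilinear_laplacian_right_eq_left a b (innerSL ℝ)
  rw [dirichletForm_apply, dirichletForm_apply, this]
  simp only [real_inner_comm]

lemma dirichletForm_scaling (a b : SchwartzMap E3 E3) :
    dirichletForm (scaling a) b = -dirichletForm a (scaling b) - 3 * dirichletForm a b := by
  simp only [dirichletForm_apply, laplacian_scaling, integral_inner_scaling,
    add_apply, smul_apply, inner_add_right, real_inner_smul_right]
  rw [integral_add (integrable_inner _ _) ((integrable_inner _ _).const_mul _), integral_const_mul]
  ring

lemma dirichletForm_self (v : SchwartzMap E3 E3) : dirichletForm v v = gradNormSq v := by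
  have hpd : ∀ (i k : Fin 3) (x : E3),
      pd (fun y => v y i) k x = (∂_{ebasis k} v) x i := fun i k x => by
    have h : HasFDerivAt (fun y => v y i) _ x :=
      (EuclideanSpace.proj i : E3 →L[ℝ] ℝ).hasFDerivAt.comp x (v.hasFDerivAt x)
    rw [pd, h.fderiv, SchwartzMap.lineDerivOp_apply_eq_fderiv]
    rfl
  have hint : ∀ i k : Fin 3, Integrable fun x => ((∂_{ebasis k} v) x i) ^ 2 := fun i k => by
    have := (SchwartzMap.pairing (ContinuousLinearMap.mul ℝ ℝ)
      (SchwartzMap.postcompCLM (EuclideanSpace.proj i : E3 →L[ℝ] ℝ) (∂_{ebasis k} v))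
      (SchwartzMap.postcompCLM (EuclideanSpace.proj i : E3 →L[ℝ] ℝ) (∂_{ebasis k} v))).integrable
      (μ := volume)
    exact this.congr (.of_forall fun x => (pow_two _).symm)
  have hlap : Δ v = ∑ k, ∂_{ebasis k} (∂_{ebasis k} v) := by
    rw [SchwartzMap.laplacian_eq_sum (EuclideanSpace.basisFun (Fin 3) ℝ)]
    simp [ebasis]
  rw [dirichletForm_apply, hlap]
  simp only [sum_apply, inner_sum]
  rw [integral_finsetSum _ fun _ _ => integrable_inner _ _, ← Finset.sum_neg_distrib]
  simp only [← integral_inner_lineDerivOp, gradNormSq, L2normSq, hpd, Real.norm_eq_abs, sq_abs]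
  rw [Finset.sum_comm]
  refine Finset.sum_congr rfl fun k _ => ?_
  rw [← integral_finsetSum _ fun i _ => hint i k]
  refine integral_congr_ae (.of_forall fun x => ?_)
  simp [EuclideanSpace.real_norm_sq_eq]

theorem stmt1 (n : ℕ) (u : SchwartzMap E3 E3) :
    -(∫ x : E3, ⟪Svec^[n] (⇑u) x, Svec^[n] (lap (⇑u)) x⟫) =
      ∑ k ∈ Finset.range (n+1), cCoef n k * gradNormSq (Svec^[k] (⇑u)) := by
  rw [← coe_laplacian, ← coe_scaling_pow, ← coe_scaling_pow, scaling_pow_laplacian,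
    ← dirichletForm_apply,
    bilin_pow_eq_sum scaling dirichletForm dirichletForm_comm dirichletForm_scaling]
  simp only [dirichletForm_self, coe_scaling_pow]

end NSCPaper
end
end

section
/- If (u,p) is a smooth solution of NSC with viscosity κ ≥ 0, with u(t,·) and p(t,·) Schwartz for each t, then Su satisfies the commuted equation ∂_t(Su) − κΔ((S − 2)u) + ((Su)·∇)u + (u·∇)(Su) + e₃×(Su) + ∇(Sp) = 0, where Su = (x·∇)u − u (vector-field action) and Sp = x·∇p − 2p (scalar action), and (S − 2)u = Su − 2u. -/
open MeasureTheory Filter Topology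
open scoped FourierTransform ENNReal RealInnerProductSpace BigOperators

noncomputable section

namespace NSCPaper

variable {F : Type*} [NormedAddCommGroup F] [NormedSpace ℝ F]

/-- The Euler operator `f ↦ x·∇f`. -/
def euler (f : E3 → F) : E3 → F := fun x => fderiv ℝ f x x

theorem differentiable_fderiv {E : Type*} [NormedAddCommGroup E] [NormedSpace ℝ E] {f : E → F}
    (hf : ContDiff ℝ 2 f) : Differentiable ℝ (fderiv ℝ f) :=
  (hf.fderiv_right (m := 1) (by norm_num)).differentiable (by norm_num)

theorem fderiv_fderiv_comm {E : Type*} [NormedAddCommGroup E] [NormedSpace ℝ E] {f : E → F}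
    (hf : ContDiff ℝ 2 f) (x v w : E) :
    fderiv ℝ (fderiv ℝ f) x v w = fderiv ℝ (fderiv ℝ f) x w v :=
  (hf.contDiffAt.isSymmSndFDerivAt (by simp)).eq v w

theorem fderiv_fderiv_apply_const {E : Type*} [NormedAddCommGroup E] [NormedSpace ℝ E] {f : E → F}
    (hf : ContDiff ℝ 2 f) (x v w : E) :
    fderiv ℝ (fun y => fderiv ℝ f y v) x w = fderiv ℝ (fderiv ℝ f) x w v := by
  rw [fderiv_clm_apply (differentiable_fderiv hf x) (differentiableAt_const v)]
  simp

theorem contDiff_pd {n : WithTop ℕ∞} {f : E3 → F} (hf : ContDiff ℝ (n + 1) f) (k : Fin 3) :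
    ContDiff ℝ n (pd f k) :=
  (hf.fderiv_right le_rfl).clm_apply contDiff_const

theorem contDiff_euler {n : WithTop ℕ∞} {f : E3 → F} (hf : ContDiff ℝ (n + 1) f) :
    ContDiff ℝ n (euler f) :=
  (hf.fderiv_right le_rfl).clm_apply contDiff_id

theorem fderiv_euler {f : E3 → F} (hf : ContDiff ℝ 2 f) (x v : E3) :
    fderiv ℝ (euler f) x v = fderiv ℝ (fderiv ℝ f) x v x + fderiv ℝ f x v := by
  unfold euler
  rw [fderiv_clm_apply (differentiable_fderiv hf x) differentiableAt_fun_id]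
  simp [add_comm]

theorem pd_euler {f : E3 → F} (hf : ContDiff ℝ 2 f) (k : Fin 3) :
    pd (euler f) k = fun x => euler (pd f k) x + pd f k x := by
  funext x
  have h : euler (pd f k) x = fderiv ℝ (fderiv ℝ f) x x (ebasis k) :=
    fderiv_fderiv_apply_const hf x (ebasis k) x
  rw [h, ← fderiv_fderiv_comm hf]
  exact fderiv_euler hf x (ebasis k)

theorem pd_add {f g : E3 → F} (hf : Differentiable ℝ f) (hg : Differentiable ℝ g) (k : Fin 3) :
    pd (fun x => f x + g x) k = fun x => pd f k x + pd g k x := by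
  funext x
  simp [pd, fderiv_fun_add (hf x) (hg x)]

theorem pd_sub_smul {f g : E3 → F} (hf : Differentiable ℝ f) (hg : Differentiable ℝ g) (c : ℝ)
    (k : Fin 3) : pd (fun x => f x - c • g x) k = fun x => pd f k x - c • pd g k x := by
  funext x
  simp [pd, fderiv_fun_sub (hf x) ((hg x).fun_const_smul c), fderiv_fun_const_smul (hg x)]

theorem pd_pd_euler {f : E3 → F} (hf : ContDiff ℝ 3 f) (k : Fin 3) (x : E3) :
    pd (pd (euler f) k) k x = euler (pd (pd f k) k) x + (2 : ℝ) • pd (pd f k) k x := by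
  have h2 : ContDiff ℝ 2 (pd f k) := contDiff_pd (n := 2) (by norm_num; exact hf) k
  rw [pd_euler (hf.of_le (by norm_num)), pd_add
    ((contDiff_euler (n := 1) (by norm_num; exact h2)).differentiable (by norm_num))
    (h2.differentiable (by norm_num)), pd_euler h2, two_smul]
  exact add_assoc _ _ _

theorem lap_sub_smul {f g : E3 → F} (hf : ContDiff ℝ 2 f) (hg : ContDiff ℝ 2 g) (c : ℝ) (x : E3) :
    lap (fun y => f y - c • g y) x = lap f x - c • lap g x := by
  have h (f : E3 → F) (hf : ContDiff ℝ 2 f) (k : Fin 3) : Differentiable ℝ (pd f k) :=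
    (contDiff_pd (n := 1) (by norm_num; exact hf) k).differentiable (by norm_num)
  simp only [lap, pd_sub_smul (hf.differentiable (by norm_num)) (hg.differentiable (by norm_num)),
    pd_sub_smul (h f hf _) (h g hg _), Finset.sum_sub_distrib, Finset.smul_sum]

theorem differentiable_pd_pd {f : E3 → F} (hf : ContDiff ℝ 3 f) (k : Fin 3) :
    Differentiable ℝ (pd (pd f k) k) :=
  (contDiff_pd (n := 1) (contDiff_pd (n := 1 + 1) (by norm_num; exact hf) k) k).differentiable
    (by norm_num)

theorem differentiable_lap {f : E3 → F} (hf : ContDiff ℝ 3 f) : Differentiable ℝ (lap f) := by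
  unfold lap
  exact Differentiable.fun_sum fun k _ => differentiable_pd_pd hf k

theorem lap_euler {f : E3 → F} (hf : ContDiff ℝ 3 f) (x : E3) :
    lap (euler f) x = euler (lap f) x + (2 : ℝ) • lap f x := by
  have h : euler (lap f) x = ∑ k, euler (pd (pd f k) k) x := by
    unfold lap euler
    rw [fderiv_fun_sum fun k _ => differentiable_pd_pd hf k x]
    simp
  rw [h]
  simp only [lap, pd_pd_euler hf, Finset.sum_add_distrib, Finset.smul_sum]

/-- The vector `(ℓ(e₁), ℓ(e₂), ℓ(e₃))` of a linear form `ℓ`, so that `grad f x` is the vector of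
`fderiv ℝ f x`. -/
def coords : (E3 →L[ℝ] ℝ) →L[ℝ] E3 :=
  ((EuclideanSpace.equiv (Fin 3) ℝ).symm : (Fin 3 → ℝ) →L[ℝ] E3).comp
    (ContinuousLinearMap.pi fun k => ContinuousLinearMap.apply ℝ ℝ (ebasis k))

theorem grad_eq_coords (f : E3 → ℝ) : grad f = fun x => coords (fderiv ℝ f x) := rfl

theorem differentiable_grad {f : E3 → ℝ} (hf : ContDiff ℝ 2 f) : Differentiable ℝ (grad f) :=
  coords.differentiable.comp (differentiable_fderiv hf)

theorem euler_grad {f : E3 → ℝ} (hf : ContDiff ℝ 2 f) (x : E3) :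
    euler (grad f) x = coords (fderiv ℝ (fderiv ℝ f) x x) := by
  have h : HasFDerivAt (grad f) (coords.comp (fderiv ℝ (fderiv ℝ f) x)) x :=
    coords.hasFDerivAt.comp x (differentiable_fderiv hf x).hasFDerivAt
  rw [euler, h.fderiv, ContinuousLinearMap.comp_apply]

theorem grad_Sscal {f : E3 → ℝ} (hf : ContDiff ℝ 2 f) (x : E3) :
    grad (Sscal f) x = euler (grad f) x - grad f x := by
  have hd : DifferentiableAt ℝ f x := hf.differentiable (by norm_num) x
  have he : DifferentiableAt ℝ (euler f) x :=
    (contDiff_euler (n := 1) (by norm_num; exact hf)).differentiable (by norm_num) x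
  have key : fderiv ℝ (Sscal f) x = fderiv ℝ (fderiv ℝ f) x x - fderiv ℝ f x := by
    ext v
    change fderiv ℝ (fun y => euler f y - (2 : ℝ) • f y) x v = _
    rw [fderiv_fun_sub he (hd.fun_const_smul 2), fderiv_fun_const_smul hd]
    change fderiv ℝ (euler f) x v - (2 : ℝ) • fderiv ℝ f x v =
      fderiv ℝ (fderiv ℝ f) x x v - fderiv ℝ f x v
    rw [fderiv_euler hf, fderiv_fderiv_comm hf x v x]
    module
  rw [euler_grad hf, grad_eq_coords, grad_eq_coords]
  simp only [key, map_sub]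

/-- `v ↦ e₃ × v` as a continuous linear map. -/
def e3crossL : E3 →L[ℝ] E3 :=
  LinearMap.toContinuousLinearMap
    { toFun := e3cross
      map_add' := fun v w => by
        ext i; fin_cases i <;> simp [e3cross, vec3, add_comm]
      map_smul' := fun c v => by
        ext i; fin_cases i <;> simp [e3cross, vec3] }

theorem e3cross_eq_e3crossL (v : E3) : e3cross v = e3crossL v := rfl

theorem euler_convection {v : E3 → E3} (hv : ContDiff ℝ 2 v) (x : E3) :
    euler (fun y => fderiv ℝ v y (v y)) x =
      fderiv ℝ (fderiv ℝ v) x x (v x) + fderiv ℝ v x (euler v x) := by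
  unfold euler
  rw [fderiv_clm_apply (differentiable_fderiv hv x) (hv.differentiable (by norm_num) x)]
  simp [add_comm]

theorem fderiv_Svec {v : E3 → E3} (hv : ContDiff ℝ 2 v) (x w : E3) :
    fderiv ℝ (Svec v) x w = fderiv ℝ (fderiv ℝ v) x x w := by
  change fderiv ℝ (fun y => euler v y - v y) x w = _
  rw [fderiv_fun_sub ((contDiff_euler (n := 1) (by norm_num; exact hv)).differentiable
    (by norm_num) x) (hv.differentiable (by norm_num) x)]
  simp [fderiv_euler hv, fderiv_fderiv_comm hv x w x]

/-- The Navier–Stokes–Coriolis right-hand side commutes with the scaling vector field. -/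
theorem Svec_rhs (κ : ℝ) {v : E3 → E3} {q : E3 → ℝ} (hv : ContDiff ℝ 4 v) (hq : ContDiff ℝ 2 q)
    (x : E3) :
    Svec (fun y => κ • lap v y - fderiv ℝ v y (v y) - e3cross (v y) - grad q y) x =
      κ • lap (fun y => Svec v y - (2 : ℝ) • v y) x - fderiv ℝ v x (Svec v x) -
        fderiv ℝ (Svec v) x (v x) - e3cross (Svec v x) - grad (Sscal q) x := by
  have hv3 : ContDiff ℝ 3 v := hv.of_le (by norm_num)
  have hv2 : ContDiff ℝ 2 v := hv.of_le (by norm_num)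
  have hd : Differentiable ℝ v := hv.differentiable (by norm_num)
  have hl := differentiable_lap hv3 x
  have hc : DifferentiableAt ℝ (fun y => fderiv ℝ v y (v y)) x :=
    (differentiable_fderiv hv2 x).clm_apply (hd x)
  have he : HasFDerivAt (fun y => e3cross (v y)) (e3crossL.comp (fderiv ℝ v x)) x :=
    e3crossL.hasFDerivAt.comp x (hd x).hasFDerivAt
  have hg := differentiable_grad hq x
  have hfd : fderiv ℝ (fun y => κ • lap v y - fderiv ℝ v y (v y) - e3cross (v y) - grad q y) x x =
      κ • euler (lap v) x - euler (fun y => fderiv ℝ v y (v y)) x - e3crossL (euler v x) -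
        euler (grad q) x := by
    rw [((((hl.hasFDerivAt.fun_const_smul κ).fun_sub hc.hasFDerivAt).fun_sub he).fun_sub
      hg.hasFDerivAt).fderiv]
    rfl
  have hlap : lap (fun y => Svec v y - (2 : ℝ) • v y) x =
      euler (lap v) x + (2 : ℝ) • lap v x - (3 : ℝ) • lap v x := by
    have hfun : (fun y => Svec v y - (2 : ℝ) • v y) = fun y => euler v y - (3 : ℝ) • v y := by
      funext y
      simp only [Svec, euler]
      module
    rw [hfun, lap_sub_smul (contDiff_euler (hv.of_le (by norm_num))) hv2, lap_euler hv3]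
  have hS : Svec v x = euler v x - v x := rfl
  rw [hlap, grad_Sscal hq, fderiv_Svec hv2, hS, Svec, hfd, euler_convection hv2]
  simp only [e3cross_eq_e3crossL, map_sub]
  module

/-- Time and space derivatives of a jointly `C²` function commute. -/
theorem hasDerivAt_fderiv_apply {w : ℝ → E3 → F} (hw : ContDiff ℝ 2 (Function.uncurry w))
    (t : ℝ) (x v : E3) :
    HasDerivAt (fun s => fderiv ℝ (w s) x v)
      (fderiv ℝ (fun y => deriv (fun s => w s y) t) x v) t := by
  set W := Function.uncurry w
  have hWd : Differentiable ℝ W := hw.differentiable (by norm_num)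
  have hx (s : ℝ) (y : E3) : HasFDerivAt (fun z : E3 => (s, z)) (.inr ℝ ℝ E3) y :=
    hasFDerivAt_prodMk_right s y
  have ht (s : ℝ) (y : E3) : HasDerivAt (fun r : ℝ => (r, y)) ((1 : ℝ), (0 : E3)) s :=
    (hasDerivAt_id s).prodMk (hasDerivAt_const s y)
  have hspace (s : ℝ) : fderiv ℝ (w s) x v = fderiv ℝ W (s, x) (0, v) := by
    have h : HasFDerivAt (w s) ((fderiv ℝ W (s, x)).comp (.inr ℝ ℝ E3)) x :=
      (hWd (s, x)).hasFDerivAt.comp x (hx s x)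
    rw [h.fderiv, ContinuousLinearMap.comp_apply, ContinuousLinearMap.inr_apply]
  have htime (y : E3) : deriv (fun s => w s y) t = fderiv ℝ W (t, y) (1, 0) := by
    have h : HasDerivAt (fun s => w s y) (fderiv ℝ W (t, y) (1, 0)) t :=
      HasFDerivAt.comp_hasDerivAt (l := W) t (hWd (t, y)).hasFDerivAt (ht t y)
    exact h.deriv
  have hconst (a : ℝ × E3) : DifferentiableAt ℝ (fun z => fderiv ℝ W z a) (t, x) :=
    (differentiable_fderiv hw (t, x)).clm_apply (differentiableAt_const a)
  have hval : fderiv ℝ (fun y => fderiv ℝ W (t, y) (1, 0)) x v =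
      fderiv ℝ (fun z => fderiv ℝ W z (0, v)) (t, x) (1, 0) := by
    have := ((hconst (1, 0)).hasFDerivAt.comp x (hx t x)).fderiv
    refine (congrArg (fun L => L v) this).trans ?_
    simp only [ContinuousLinearMap.comp_apply, ContinuousLinearMap.inr_apply,
      fderiv_fderiv_apply_const hw]
    exact fderiv_fderiv_comm hw _ _ _
  simp only [hspace, htime, hval]
  exact (hconst (0, v)).hasFDerivAt.comp_hasDerivAt t (ht t x)

-- STATEMENT 6
theorem stmt6 (κ T : ℝ) (hκ : 0 ≤ κ) (hT : 0 < T)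
    (u : ℝ → E3 → E3) (p : ℝ → E3 → ℝ) (h : IsSmoothSchwartzSolution κ T u p) :
    ∀ t ∈ Set.Icc (0:ℝ) T, ∀ x : E3,
      derivWithin (fun s => Svec (u s) x) (Set.Icc 0 T) t -
          κ • lap (fun y => Svec (u t) y - (2:ℝ) • u t y) x +
          fderiv ℝ (u t) x (Svec (u t) x) + fderiv ℝ (Svec (u t)) x (u t x) +
          e3cross (Svec (u t) x) + grad (Sscal (p t)) x = 0 := by
  intro t ht x
  have hU : ContDiff ℝ 2 (Function.uncurry u) := h.usmooth.of_le (WithTop.coe_le_coe.2 (le_top : (2 : ℕ∞) ≤ ⊤))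
  have hu : ContDiff ℝ 4 (u t) :=
    (h.usmooth.of_le (WithTop.coe_le_coe.2 (le_top : (4 : ℕ∞) ≤ ⊤))).comp (contDiff_prodMk_right t)
  have hp : ContDiff ℝ 2 (p t) :=
    (h.psmooth.of_le (WithTop.coe_le_coe.2 (le_top : (2 : ℕ∞) ≤ ⊤))).comp (contDiff_prodMk_right t)
  have huniq : UniqueDiffWithinAt ℝ (Set.Icc 0 T) t := uniqueDiffOn_Icc hT t ht
  have hdiff (y : E3) : DifferentiableAt ℝ (fun s => u s y) t :=
    (hU.comp (contDiff_prodMk_left y)).differentiable (by norm_num) t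
  have hderiv : (fun y => deriv (fun s => u s y) t) = fun y =>
      κ • lap (u t) y - fderiv ℝ (u t) y (u t y) - e3cross (u t y) - grad (p t) y := by
    funext y
    rw [← (hdiff y).derivWithin huniq]
    exact (h.sol.eqn t ht y).derivWithin huniq
  have hS : derivWithin (fun s => Svec (u s) x) (Set.Icc 0 T) t =
      Svec (fun y => deriv (fun s => u s y) t) x :=
    ((hasDerivAt_fderiv_apply hU t x x).fun_sub (hdiff x).hasDerivAt).hasDerivWithinAt.derivWithin
      huniq
  rw [hS, hderiv, Svec_rhs κ hu hp]
  abel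

end NSCPaper
end
end

section
/- Let ξ, η ∈ ℝ³ with ξ, ξ−η, η all nonzero, and let k, k₁, k₂ ∈ ℤ and integers p, p₁, p₂, q, q₁, q₂ ≤ 0 be such that: 2^{k−1} ≤ |ξ| ≤ 2^{k+1}, 2^{p−1} ≤ √(1−Λ(ξ)²) ≤ 2^{p+1}, 2^{q−1} ≤ |Λ(ξ)| ≤ 2^{q+1}, and the analogous inequalities hold for ξ−η with indices (k₁,p₁,q₁) and for η with indices (k₂,p₂,q₂). Set q_max = max(q,q₁,q₂), p_max = max(p,p₁,p₂), k_max = max(k,k₁,k₂), k_min = min(k,k₁,k₂). There exist absolute constants C₀ ≥ 0 and c > 0 such that: if |Φ_μ^{μ₁,μ₂}(ξ,η)| ≤ 2^{q_max − 10} for some signs μ, μ₁, μ₂ ∈ {+,−}, then p_max ≥ −C₀ and |σ̄(ξ,η)| ≥ c·2^{q_max}·2^{k_max + k_min}. -/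
open MeasureTheory Filter Topology
open scoped FourierTransform ENNReal RealInnerProductSpace BigOperators

noncomputable section

namespace NSCPaper

variable {F : Type*} [NormedAddCommGroup F] [NormedSpace ℝ F]

lemma norm_vec2 (a b : ℝ) : ‖vec2 a b‖ = Real.sqrt (a ^ 2 + b ^ 2) := by
  simp [vec2, EuclideanSpace.norm_eq, Fin.sum_univ_two]

lemma norm_sq_eq_horNorm_sq_add (x : E3) : ‖x‖ ^ 2 = horNorm x ^ 2 + x 2 ^ 2 := by
  rw [EuclideanSpace.real_norm_sq_eq, horNorm, Real.sq_sqrt (by positivity), Fin.sum_univ_three]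

lemma abs_Lam_mul_norm {x : E3} (hx : x ≠ 0) : |Lam x| * ‖x‖ = |x 2| := by
  have := norm_pos_iff.2 hx
  rw [Lam, abs_div, abs_norm, div_mul_cancel₀ _ this.ne']

lemma horNorm_eq {x : E3} (hx : x ≠ 0) : horNorm x = ‖x‖ * Real.sqrt (1 - Lam x ^ 2) := by
  have hpos := norm_pos_iff.2 hx
  have h : 1 - Lam x ^ 2 = horNorm x ^ 2 / ‖x‖ ^ 2 := by
    rw [Lam]
    field_simp
    linarith [norm_sq_eq_horNorm_sq_add x]
  rw [h, Real.sqrt_div (sq_nonneg _), Real.sqrt_sq (show 0 ≤ horNorm x from Real.sqrt_nonneg _),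
    Real.sqrt_sq hpos.le, mul_div_cancel₀ _ hpos.ne']

lemma abs_Lam_le_one (x : E3) : |Lam x| ≤ 1 := by
  rw [Lam, abs_div, abs_norm]
  exact div_le_one_of_le₀ (PiLp.norm_apply_le x 2) (norm_nonneg x)

lemma sub_le_norm_sigmaBar (x y : E3) :
    |x 2| * horNorm y - |y 2| * horNorm x ≤ ‖sigmaBar x y‖ := by
  have h : sigmaBar x y = x 2 • vec2 (y 0) (y 1) - y 2 • vec2 (x 0) (x 1) := by
    ext i
    fin_cases i <;> simp [sigmaBar, vec2]
  rw [h]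
  refine le_trans (le_of_eq ?_) (norm_sub_norm_le _ _)
  simp only [norm_smul, norm_vec2, horNorm, Real.norm_eq_abs]

lemma half_le_sqrt_one_sub_Lam_sq {x y : E3} (h : |Lam y| ≤ 3 / 4 * |Lam x|) :
    1 / 2 ≤ Real.sqrt (1 - Lam y ^ 2) := by
  apply Real.le_sqrt_of_sq_le
  nlinarith [abs_Lam_le_one x, abs_nonneg (Lam y), sq_abs (Lam y)]

lemma norm_mul_norm_mul_abs_Lam_le_norm_sigmaBar {x y : E3} (hx : x ≠ 0) (hy : y ≠ 0)
    (h : |Lam y| ≤ 3 / 4 * |Lam x|) :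
    ‖x‖ * ‖y‖ * |Lam x| / 8 ≤ ‖sigmaBar x y‖ := by
  refine le_trans ?_ (sub_le_norm_sigmaBar x y)
  rw [← abs_Lam_mul_norm hx, ← abs_Lam_mul_norm hy, horNorm_eq hx, horNorm_eq hy]
  have hyx : |Lam y| ≤ |Lam x| := by linarith [abs_nonneg (Lam x)]
  have hs : Real.sqrt (1 - Lam x ^ 2) ≤ Real.sqrt (1 - Lam y ^ 2) :=
    Real.sqrt_le_sqrt (by linarith [sq_le_sq.2 hyx])
  have key : |Lam x| / 8 ≤
      |Lam x| * Real.sqrt (1 - Lam y ^ 2) - |Lam y| * Real.sqrt (1 - Lam x ^ 2) := by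
    have h₁ := mul_le_mul_of_nonneg_left hs (abs_nonneg (Lam y))
    have h₂ := mul_le_mul (show |Lam x| / 4 ≤ |Lam x| - |Lam y| by linarith)
      (half_le_sqrt_one_sub_Lam_sq h) (by norm_num) (by linarith)
    linarith
  have := mul_le_mul_of_nonneg_left key (mul_nonneg (norm_nonneg x) (norm_nonneg y))
  linarith

lemma norm_sigmaBar_swap (x y : E3) : ‖sigmaBar y x‖ = ‖sigmaBar x y‖ := by
  rw [sigmaBar, sigmaBar, norm_vec2, norm_vec2]
  ring_nf

lemma norm_sigmaBar_sub_right (x y : E3) : ‖sigmaBar x (x - y)‖ = ‖sigmaBar x y‖ := by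
  simp only [sigmaBar, norm_vec2, PiLp.sub_apply]
  ring_nf

lemma norm_sigmaBar_sub_left (x y : E3) : ‖sigmaBar (x - y) y‖ = ‖sigmaBar x y‖ := by
  simp only [sigmaBar, norm_vec2, PiLp.sub_apply]
  ring_nf

/-- If a signed sum of three reals is small compared to the largest modulus, then one of them is
significantly smaller than the largest one. -/
lemma exists_abs_le_of_abs_signed_sum_le {Q a b c μ μ₁ μ₂ : ℝ} (hQ : 0 < Q)
    (hμ : μ ∈ pmSet) (hμ₁ : μ₁ ∈ pmSet) (hμ₂ : μ₂ ∈ pmSet)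
    (hmax : Q ≤ 2 * |a| ∨ Q ≤ 2 * |b| ∨ Q ≤ 2 * |c|)
    (h : |μ * a + μ₁ * b + μ₂ * c| ≤ Q / 1024) :
    (Q ≤ 2 * |a| ∧ (|b| ≤ 3 / 4 * |a| ∨ |c| ≤ 3 / 4 * |a|)) ∨
    (Q ≤ 2 * |b| ∧ (|a| ≤ 3 / 4 * |b| ∨ |c| ≤ 3 / 4 * |b|)) ∨
    (Q ≤ 2 * |c| ∧ (|a| ≤ 3 / 4 * |c| ∨ |b| ≤ 3 / 4 * |c|)) := by
  have habs : ∀ ν ∈ pmSet, ∀ t : ℝ, ν * t = |t| ∨ ν * t = -|t| := by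
    rintro ν (rfl | rfl) t <;> rcases abs_choice t with h | h <;> simp [h]
  obtain ⟨h₁, h₂⟩ := abs_le.1 h
  rcases habs μ hμ a with ha | ha <;> rcases habs μ₁ hμ₁ b with hb | hb <;>
    rcases habs μ₂ hμ₂ c with hc | hc <;> rw [ha, hb, hc] at h₁ h₂ <;>
    clear ha hb hc h <;> grind

lemma max_mul_min_le_two_mul {a b c : ℝ} (ha : 0 ≤ a) (hb : 0 ≤ b) (hc : c ≤ a + b) :
    max a (max b c) * min a (min b c) ≤ 2 * (a * b) := by
  have h₁ : max a (max b c) ≤ 2 * max a b := by grind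
  have h₂ : min a (min b c) ≤ min a b := by grind
  have h₃ : 0 ≤ max a b := le_max_of_le_left ha
  rw [← max_mul_min a b]
  calc _ ≤ max a (max b c) * min a b := by gcongr
    _ ≤ 2 * max a b * min a b := by gcongr
    _ = _ := by ring

lemma two_zpow_le_two_mul {a : ℝ} {k : ℤ} (h : (2 : ℝ) ^ (k - 1) ≤ a) : (2 : ℝ) ^ k ≤ 2 * a := by
  rw [zpow_sub_one₀ two_ne_zero] at h
  linarith

lemma two_zpow_max_add_min_le {a b c : ℝ} {k k₁ k₂ : ℤ} (ha : (2 : ℝ) ^ (k - 1) ≤ a)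
    (hb : (2 : ℝ) ^ (k₁ - 1) ≤ b) (hc : (2 : ℝ) ^ (k₂ - 1) ≤ c) :
    (2 : ℝ) ^ (max k (max k₁ k₂) + min k (min k₁ k₂)) ≤
      4 * (max a (max b c) * min a (min b c)) := by
  have hmono : Monotone fun n : ℤ => (2 : ℝ) ^ n := zpow_right_mono₀ one_le_two
  replace ha := two_zpow_le_two_mul ha
  replace hb := two_zpow_le_two_mul hb
  replace hc := two_zpow_le_two_mul hc
  have hk : (0 : ℝ) < 2 ^ k := by positivity
  have h₁ : (2 : ℝ) ^ max k (max k₁ k₂) ≤ 2 * max a (max b c) := by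
    have := hmono.map_max (a := k) (b := max k₁ k₂)
    have := hmono.map_max (a := k₁) (b := k₂)
    grind
  have h₂ : (2 : ℝ) ^ min k (min k₁ k₂) ≤ 2 * min a (min b c) := by
    have := hmono.map_min (a := k) (b := min k₁ k₂)
    have := hmono.map_min (a := k₁) (b := k₂)
    grind
  rw [zpow_add₀ two_ne_zero]
  calc _ ≤ 2 * max a (max b c) * (2 * min a (min b c)) :=
        mul_le_mul h₁ h₂ (by positivity) (by grind)
    _ = _ := by ring

lemma neg_two_le_of_half_le {s : ℝ} {p : ℤ} (h : 1 / 2 ≤ s) (hs : s ≤ (2 : ℝ) ^ (p + 1)) :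
    -2 ≤ p := by
  have : (2 : ℝ) ^ (-1 : ℤ) ≤ 2 ^ (p + 1) := by
    norm_num at h ⊢
    linarith
  have := (zpow_le_zpow_iff_right₀ one_lt_two).1 this
  omega

-- STATEMENT 8
theorem stmt8 :
    ∃ C₀ c : ℝ, 0 ≤ C₀ ∧ 0 < c ∧
      ∀ (ξ η : E3) (k k₁ k₂ p p₁ p₂ q q₁ q₂ : ℤ),
        ξ ≠ 0 → ξ - η ≠ 0 → η ≠ 0 →
        p ≤ 0 → p₁ ≤ 0 → p₂ ≤ 0 → q ≤ 0 → q₁ ≤ 0 → q₂ ≤ 0 →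
        DyadicK ξ k → DyadicP ξ p → DyadicQ ξ q →
        DyadicK (ξ - η) k₁ → DyadicP (ξ - η) p₁ → DyadicQ (ξ - η) q₁ →
        DyadicK η k₂ → DyadicP η p₂ → DyadicQ η q₂ →
        (∃ μ ∈ pmSet, ∃ μ₁ ∈ pmSet, ∃ μ₂ ∈ pmSet,
            |Phase μ μ₁ μ₂ ξ η| ≤ (2:ℝ)^(max q (max q₁ q₂) - 10)) →
        (-C₀ ≤ ((max p (max p₁ p₂) : ℤ) : ℝ)) ∧
          c * (2:ℝ)^(max q (max q₁ q₂)) * (2:ℝ)^(max k (max k₁ k₂) + min k (min k₁ k₂)) ≤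
            ‖sigmaBar ξ η‖ := by
  refine ⟨2, 1 / 128, by norm_num, by norm_num, ?_⟩
  intro ξ η k k₁ k₂ p p₁ p₂ q q₁ q₂ hξ hξη hη _ _ _ _ _ _ hk hp hq hk₁ hp₁ hq₁ hk₂ hp₂ hq₂
  rintro ⟨μ, hμ, μ₁, hμ₁, μ₂, hμ₂, hΦ⟩
  have hK := two_zpow_max_add_min_le hk.1 hk₁.1 hk₂.1
  have hmax : (2 : ℝ) ^ max q (max q₁ q₂) ≤ 2 * |Lam ξ| ∨
      (2 : ℝ) ^ max q (max q₁ q₂) ≤ 2 * |Lam (ξ - η)| ∨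
      (2 : ℝ) ^ max q (max q₁ q₂) ≤ 2 * |Lam η| := by
    have h := two_zpow_le_two_mul hq.1
    have h₁ := two_zpow_le_two_mul hq₁.1
    have h₂ := two_zpow_le_two_mul hq₂.1
    rcases max_choice q (max q₁ q₂) with e | e
    · exact .inl (by rwa [e])
    · rcases max_choice q₁ q₂ with e' | e'
      · exact .inr (.inl (by rwa [e, e']))
      · exact .inr (.inr (by rwa [e, e']))
  have hQ : (0 : ℝ) < 2 ^ max q (max q₁ q₂) := by positivity
  have hK0 : (0 : ℝ) < 2 ^ (max k (max k₁ k₂) + min k (min k₁ k₂)) := by positivity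
  rw [zpow_sub₀ two_ne_zero] at hΦ
  norm_num only at hΦ
  generalize (2 : ℝ) ^ max q (max q₁ q₂) = Q at *
  generalize (2 : ℝ) ^ (max k (max k₁ k₂) + min k (min k₁ k₂)) = K at *
  have t₁ : ‖ξ‖ ≤ ‖ξ - η‖ + ‖η‖ := norm_le_norm_sub_add ξ η
  have t₂ : ‖ξ - η‖ ≤ ‖ξ‖ + ‖η‖ := norm_sub_le ξ η
  have t₃ : ‖η‖ ≤ ‖ξ‖ + ‖ξ - η‖ := norm_le_insert ξ η
  have n₀ := norm_nonneg ξ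
  have n₁ := norm_nonneg (ξ - η)
  have n₂ := norm_nonneg η
  have m₁ : K ≤ 8 * (‖ξ‖ * ‖ξ - η‖) := by
    have := max_mul_min_le_two_mul n₀ n₁ t₃
    linarith
  have m₂ : K ≤ 8 * (‖ξ‖ * ‖η‖) := by
    have := max_mul_min_le_two_mul n₀ n₂ t₂
    rw [max_comm ‖η‖, min_comm ‖η‖] at this
    linarith
  have m₃ : K ≤ 8 * (‖ξ - η‖ * ‖η‖) := by
    have := max_mul_min_le_two_mul n₁ n₂ t₁
    rw [← max_assoc, max_comm _ ‖ξ‖, ← min_assoc, min_comm _ ‖ξ‖] at this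
    linarith
  have s₁ := norm_sigmaBar_sub_right ξ η
  have s₁' := norm_sigmaBar_swap ξ (ξ - η)
  have s₂' := norm_sigmaBar_swap ξ η
  have s₃ := norm_sigmaBar_sub_left ξ η
  have s₃' := norm_sigmaBar_swap (ξ - η) η
  have core : ∀ {x y : E3} {r : ℤ}, x ≠ 0 → y ≠ 0 → DyadicP y r → Q ≤ 2 * |Lam x| →
      K ≤ 8 * (‖x‖ * ‖y‖) → |Lam y| ≤ 3 / 4 * |Lam x| →
      -2 ≤ r ∧ 1 / 128 * Q * K ≤ ‖sigmaBar x y‖ := by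
    intro x y r hx hy hr hQx hKxy hxy
    refine ⟨neg_two_le_of_half_le (half_le_sqrt_one_sub_Lam_sq hxy) hr.2, ?_⟩
    have := norm_mul_norm_mul_abs_Lam_le_norm_sigmaBar hx hy hxy
    have := mul_le_mul hQx hKxy hK0.le (by positivity)
    linarith
  suffices h : -2 ≤ max p (max p₁ p₂) ∧ 1 / 128 * Q * K ≤ ‖sigmaBar ξ η‖ from
    ⟨by exact_mod_cast h.1, h.2⟩
  rcases exists_abs_le_of_abs_signed_sum_le hQ hμ hμ₁ hμ₂ hmax hΦ with
    ⟨hx, h | h⟩ | ⟨hx, h | h⟩ | ⟨hx, h | h⟩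
  · obtain ⟨h₁, h₂⟩ := core hξ hξη hp₁ hx m₁ h
    exact ⟨by omega, by linarith⟩
  · obtain ⟨h₁, h₂⟩ := core hξ hη hp₂ hx m₂ h
    exact ⟨by omega, by linarith⟩
  · obtain ⟨h₁, h₂⟩ := core hξη hξ hp hx (by linarith) h
    exact ⟨by omega, by linarith⟩
  · obtain ⟨h₁, h₂⟩ := core hξη hη hp₂ hx m₃ h
    exact ⟨by omega, by linarith⟩
  · obtain ⟨h₁, h₂⟩ := core hη hξ hp hx (by linarith) h
    exact ⟨by omega, by linarith⟩
  · obtain ⟨h₁, h₂⟩ := core hη hξη hp₁ hx (by linarith) h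
    exact ⟨by omega, by linarith⟩

end NSCPaper
end
end

section
/- Let ξ, η ∈ ℝ³ with ξ, ξ−η, η all nonzero, and let k, k₁, k₂ ∈ ℤ and integers p, p₁, p₂, q, q₁, q₂ ≤ 0 be such that: 2^{k−1} ≤ |ξ| ≤ 2^{k+1}, 2^{p−1} ≤ √(1−Λ(ξ)²) ≤ 2^{p+1}, 2^{q−1} ≤ |Λ(ξ)| ≤ 2^{q+1}, and the analogous inequalities hold for ξ−η with indices (k₁,p₁,q₁) and for η with indices (k₂,p₂,q₂). Assume |Φ_μ^{μ₁,μ₂}(ξ,η)| ≤ 2^{max(q,q₁,q₂) − 10} for some signs μ, μ₁, μ₂ ∈ {+,−}. Then, with S_ηΦ(ξ,η) = η·∇_ηΦ_μ^{μ₁,μ₂}(ξ,η) and Ω_ηΦ(ξ,η) = (η₁∂_{η₂} − η₂∂_{η₁})Φ_μ^{μ₁,μ₂}(ξ,η), there exist absolute constants 0 < c ≤ C such that c·(|ξ_h − η_h|/|ξ−η|³)·|σ̄(ξ,η)| ≤ |S_ηΦ(ξ,η)| + |Ω_ηΦ(ξ,η)| ≤ C·(|ξ_h − η_h|/|ξ−η|³)·|σ̄(ξ,η)|.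 -/
open MeasureTheory Filter Topology
open scoped FourierTransform ENNReal RealInnerProductSpace BigOperators

noncomputable section

namespace NSCPaper

variable {F : Type*} [NormedAddCommGroup F] [NormedSpace ℝ F]

theorem hasFDerivAt_norm_inv {x : E3} (hx : x ≠ 0) :
    HasFDerivAt (fun y : E3 => ‖y‖⁻¹) (-(‖x‖ ^ 3)⁻¹ • innerSL ℝ x) x := by
  have hn : ‖x‖ ≠ 0 := norm_ne_zero_iff.mpr hx
  have h := (hasStrictFDerivAt_norm_sq x).hasFDerivAt.sqrt (pow_ne_zero 2 hn)
  simp only [Real.sqrt_sq (norm_nonneg _)] at h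
  refine ((hasDerivAt_inv hn).comp_hasFDerivAt x h).congr_fderiv ?_
  ext v
  simp
  field_simp

theorem hasFDerivAt_Lam {x : E3} (hx : x ≠ 0) :
    HasFDerivAt Lam (‖x‖⁻¹ • (EuclideanSpace.proj 2 : E3 →L[ℝ] ℝ) -
      (x 2 / ‖x‖ ^ 3) • innerSL ℝ x) x := by
  have h := (EuclideanSpace.proj (𝕜 := ℝ) (2 : Fin 3) : E3 →L[ℝ] ℝ).hasFDerivAt (x := x)
  refine (h.mul (hasFDerivAt_norm_inv hx)).congr_fderiv ?_
  ext v
  simp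
  ring

theorem fderiv_Lam_apply {x : E3} (hx : x ≠ 0) (v : E3) :
    fderiv ℝ Lam x v =
      (v 2 * ‖x‖ ^ 2 - x 2 * (x 0 * v 0 + x 1 * v 1 + x 2 * v 2)) / ‖x‖ ^ 3 := by
  have hn : ‖x‖ ≠ 0 := norm_ne_zero_iff.mpr hx
  rw [(hasFDerivAt_Lam hx).fderiv]
  simp [PiLp.inner_apply, Fin.sum_univ_three]
  field_simp

theorem fderiv_Phase_apply (μ μ₁ μ₂ : ℝ) {ξ η : E3} (hζ : ξ - η ≠ 0) (hη : η ≠ 0) (v : E3) :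
    fderiv ℝ (fun η' => Phase μ μ₁ μ₂ ξ η') η v =
      -μ₁ * fderiv ℝ Lam (ξ - η) v + μ₂ * fderiv ℝ Lam η v := by
  have hsub : HasFDerivAt (fun η' : E3 => ξ - η') (-ContinuousLinearMap.id ℝ E3) η :=
    (hasFDerivAt_id η).const_sub ξ
  have h₁ := ((hasFDerivAt_Lam hζ).differentiableAt.hasFDerivAt.comp η hsub).const_mul μ₁
  have h₂ := (hasFDerivAt_Lam hη).differentiableAt.hasFDerivAt.const_mul μ₂
  have h : HasFDerivAt (fun η' => Phase μ μ₁ μ₂ ξ η') _ η := (h₁.const_add (μ * Lam ξ)).add h₂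
  rw [h.fderiv]
  simp

theorem norm_sq_eq_coords (x : E3) : ‖x‖ ^ 2 = x 0 ^ 2 + x 1 ^ 2 + x 2 ^ 2 := by
  simp [EuclideanSpace.norm_sq_eq, Fin.sum_univ_three]

/-- `S_ηΦ = μ₁ (ξ_h − η_h) · σ̄ / |ξ − η|³`. -/
theorem fderiv_Phase_self (μ μ₁ μ₂ : ℝ) {ξ η : E3} (hζ : ξ - η ≠ 0) (hη : η ≠ 0) :
    fderiv ℝ (fun η' => Phase μ μ₁ μ₂ ξ η') η η =
      μ₁ * ((ξ - η) 0 * sigmaBar ξ η 0 + (ξ - η) 1 * sigmaBar ξ η 1) / ‖ξ - η‖ ^ 3 := by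
  rw [fderiv_Phase_apply μ μ₁ μ₂ hζ hη, fderiv_Lam_apply hζ, fderiv_Lam_apply hη,
    norm_sq_eq_coords, norm_sq_eq_coords]
  simp [sigmaBar, vec2]
  ring

/-- `Ω_ηΦ = μ₁ σ̄ ∧ (ξ_h − η_h) / |ξ − η|³`. -/
theorem rotation_fderiv_Phase (μ μ₁ μ₂ : ℝ) {ξ η : E3} (hζ : ξ - η ≠ 0) (hη : η ≠ 0) :
    η 0 * fderiv ℝ (fun η' => Phase μ μ₁ μ₂ ξ η') η (ebasis 1) -
        η 1 * fderiv ℝ (fun η' => Phase μ μ₁ μ₂ ξ η') η (ebasis 0) =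
      μ₁ * ((ξ - η) 1 * sigmaBar ξ η 0 - (ξ - η) 0 * sigmaBar ξ η 1) / ‖ξ - η‖ ^ 3 := by
  simp only [fderiv_Phase_apply μ μ₁ μ₂ hζ hη, fderiv_Lam_apply hζ, fderiv_Lam_apply hη]
  simp [sigmaBar, vec2, ebasis]
  ring

theorem fderiv_Phase_sq_add_sq (μ μ₂ : ℝ) {μ₁ : ℝ} (hμ₁ : μ₁ ∈ pmSet) {ξ η : E3}
    (hζ : ξ - η ≠ 0) (hη : η ≠ 0) :
    fderiv ℝ (fun η' => Phase μ μ₁ μ₂ ξ η') η η ^ 2 +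
        (η 0 * fderiv ℝ (fun η' => Phase μ μ₁ μ₂ ξ η') η (ebasis 1) -
          η 1 * fderiv ℝ (fun η' => Phase μ μ₁ μ₂ ξ η') η (ebasis 0)) ^ 2 =
      (horNorm (ξ - η) / ‖ξ - η‖ ^ 3 * ‖sigmaBar ξ η‖) ^ 2 := by
  have hsq : μ₁ ^ 2 = 1 := by rcases hμ₁ with rfl | rfl <;> norm_num
  have hσ : ‖sigmaBar ξ η‖ ^ 2 = sigmaBar ξ η 0 ^ 2 + sigmaBar ξ η 1 ^ 2 := by
    simp [EuclideanSpace.norm_sq_eq]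
  have hh : horNorm (ξ - η) ^ 2 = (ξ - η) 0 ^ 2 + (ξ - η) 1 ^ 2 := Real.sq_sqrt (by positivity)
  rw [fderiv_Phase_self μ μ₁ μ₂ hζ hη, rotation_fderiv_Phase μ μ₁ μ₂ hζ hη, mul_pow, div_pow,
    div_pow, div_pow, mul_pow, mul_pow, hsq, hσ, hh]
  ring

-- STATEMENT 9
theorem stmt9 :
    ∃ c C : ℝ, 0 < c ∧ c ≤ C ∧
      ∀ (ξ η : E3) (k k₁ k₂ p p₁ p₂ q q₁ q₂ : ℤ) (μ μ₁ μ₂ : ℝ),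
        ξ ≠ 0 → ξ - η ≠ 0 → η ≠ 0 →
        p ≤ 0 → p₁ ≤ 0 → p₂ ≤ 0 → q ≤ 0 → q₁ ≤ 0 → q₂ ≤ 0 →
        DyadicK ξ k → DyadicP ξ p → DyadicQ ξ q →
        DyadicK (ξ - η) k₁ → DyadicP (ξ - η) p₁ → DyadicQ (ξ - η) q₁ →
        DyadicK η k₂ → DyadicP η p₂ → DyadicQ η q₂ →
        μ ∈ pmSet → μ₁ ∈ pmSet → μ₂ ∈ pmSet →
        |Phase μ μ₁ μ₂ ξ η| ≤ (2:ℝ)^(max q (max q₁ q₂) - 10) →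
        (c * (horNorm (ξ - η) / ‖ξ - η‖^3 * ‖sigmaBar ξ η‖) ≤
            |fderiv ℝ (fun η' => Phase μ μ₁ μ₂ ξ η') η η| +
              |(η 0) * fderiv ℝ (fun η' => Phase μ μ₁ μ₂ ξ η') η (ebasis 1) -
                (η 1) * fderiv ℝ (fun η' => Phase μ μ₁ μ₂ ξ η') η (ebasis 0)|) ∧
          (|fderiv ℝ (fun η' => Phase μ μ₁ μ₂ ξ η') η η| +
              |(η 0) * fderiv ℝ (fun η' => Phase μ μ₁ μ₂ ξ η') η (ebasis 1) -
                (η 1) * fderiv ℝ (fun η' => Phase μ μ₁ μ₂ ξ η') η (ebasis 0)| ≤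
            C * (horNorm (ξ - η) / ‖ξ - η‖^3 * ‖sigmaBar ξ η‖)) := by
  refine ⟨1, 2, one_pos, one_le_two, ?_⟩
  intro ξ η k k₁ k₂ p p₁ p₂ q q₁ q₂ μ μ₁ μ₂ _ hζ hη _ _ _ _ _ _ _ _ _ _ _ _ _ _ _ _ hμ₁ _ _
  have h := fderiv_Phase_sq_add_sq μ μ₂ hμ₁ hζ hη
  have hR : 0 ≤ horNorm (ξ - η) / ‖ξ - η‖ ^ 3 * ‖sigmaBar ξ η‖ :=
    mul_nonneg (div_nonneg (Real.sqrt_nonneg _) (by positivity)) (norm_nonneg _)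
  constructor
  · rw [one_mul]
    refine abs_le_of_sq_le_sq' ?_ (by positivity) |>.2
    rw [← h, add_sq, sq_abs, sq_abs]
    nlinarith [mul_nonneg (abs_nonneg (fderiv ℝ (fun η' => Phase μ μ₁ μ₂ ξ η') η η))
      (abs_nonneg (η 0 * fderiv ℝ (fun η' => Phase μ μ₁ μ₂ ξ η') η (ebasis 1) -
          η 1 * fderiv ℝ (fun η' => Phase μ μ₁ μ₂ ξ η') η (ebasis 0)))]
  · rw [two_mul]
    exact add_le_add (abs_le_of_sq_le_sq (by rw [← h]; exact le_add_of_nonneg_right (sq_nonneg _)) hR)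
      (abs_le_of_sq_le_sq (by rw [← h]; exact le_add_of_nonneg_left (sq_nonneg _)) hR)

end NSCPaper
end
end
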